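/- arXiv:2604.02295 — 16 statements merged into one kernel-verified Lean document; each statement's English description precedes it below -/
import Mathlib

section
/- Fix B = 1 and let α, α_f ≥ 0. Then max_{(t₁,t₂)∈[0,1]²} F_TS(t₁,t₂) ≥ max_{t₁∈[0,1]} F_OS(t₁); moreover the inequality is strict whenever α ≠ α_f. (Equivalently, the one-sided matching rate η_OS = 1 − max F_OS dominates the two-sided matching rate η_TS = 1 − max F_TS at full budget B = 1, strictly when α ≠ α_f.) -/
open Set

/-- `M = 2α + (α_f − α)B`, the rate in the one-sided objective. -/
noncomputable def Mos (B α αf : ℝ) : ℝ := 2*α + (αf - α)*B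

/-- The one-sided objective `F_OS`. -/
noncomputable def FOS (B α αf t₁ : ℝ) : ℝ :=
  (1 - B) * Real.exp (-(2*α * Real.exp (-(Mos B α αf * t₁))))
  + B * Real.exp (-((α + αf) * Real.exp (-(Mos B α αf * t₁))))
  + Real.exp (-(Mos B α αf * t₁)) * (1 + Mos B α αf * t₁) - 1

/-- `M₁ = (2 − B/2)α + (B/2)α_f`. -/
noncomputable def M1 (B α αf : ℝ) : ℝ := (2 - B/2)*α + (B/2)*αf

/-- `M₂ = (1 − B/2)α + (1 + B/2)α_f`. -/
noncomputable def M2 (B α αf : ℝ) : ℝ := (1 - B/2)*α + (1 + B/2)*αf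

/-- The two-sided objective `F_TS`. -/
noncomputable def FTS (B α αf t₁ t₂ : ℝ) : ℝ :=
  (1 - B/2) * Real.exp (-(2*α*(1 - B/2) * Real.exp (-(M1 B α αf * t₁)))
      - (α + αf)*(B/2) * Real.exp (-(M2 B α αf * t₂)))
  + (B/2) * Real.exp (-((α + αf)*(1 - B/2) * Real.exp (-(M1 B α αf * t₁)))
      - αf*B * Real.exp (-(M2 B α αf * t₂)))
  + (1 - B/2) * Real.exp (-(M1 B α αf * t₁)) * (1 + M1 B α αf * t₁)
  + (B/2) * Real.exp (-(M2 B α αf * t₂)) * (1 + M2 B α αf * t₂) - 1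

/-- `max_{t₁ ∈ [0,1]} F_OS(t₁)` (the max is attained, so it equals the `sSup`). -/
noncomputable def maxOS (B α αf : ℝ) : ℝ := sSup (FOS B α αf '' Icc 0 1)

/-- `max_{(t₁,t₂) ∈ [0,1]²} F_TS(t₁,t₂)` (the max is attained, so it equals the `sSup`). -/
noncomputable def maxTS (B α αf : ℝ) : ℝ :=
  sSup ((fun p : ℝ × ℝ => FTS B α αf p.1 p.2) '' (Icc 0 1 ×ˢ Icc 0 1))

theorem fos_one (α αf t : ℝ) : FOS 1 α αf t =
    Real.exp (-((α + αf) * Real.exp (-((α + αf) * t))))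
      + Real.exp (-((α + αf) * t)) * (1 + (α + αf) * t) - 1 := by
  have h : Mos 1 α αf = α + αf := by unfold Mos; ring
  unfold FOS; rw [h]; ring

theorem fos_hasDeriv (α αf t : ℝ) : HasDerivAt (FOS 1 α αf)
    ((α + αf)^2 * Real.exp (-((α + αf) * t)) *
      (Real.exp (-((α + αf) * Real.exp (-((α + αf) * t)))) - t)) t := by
  have h0 : FOS 1 α αf = fun t => Real.exp (-((α + αf) * Real.exp (-((α + αf) * t))))
      + Real.exp (-((α + αf) * t)) * (1 + (α + αf) * t) - 1 := funext (fos_one α αf)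
  rw [h0]
  have hl : HasDerivAt (fun t : ℝ => (α + αf) * t) (α + αf) t := by
    simpa using (hasDerivAt_id t).const_mul (α + αf)
  have hz := hl.neg.exp
  have hE := (hz.const_mul (α + αf)).neg.exp
  have := (hE.add (hz.mul (hl.const_add 1))).sub_const 1
  refine this.congr_deriv ?_
  simp only [Pi.neg_apply]
  ring

theorem fos_crit (α αf : ℝ) (hs : 0 < α + αf) :
    ∃ t ∈ Icc (0:ℝ) 1, (∀ y ∈ Icc (0:ℝ) 1, FOS 1 α αf y ≤ FOS 1 α αf t) ∧
      Real.exp (-((α + αf) * Real.exp (-((α + αf) * t)))) = t := by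
  have hd : Differentiable ℝ (FOS 1 α αf) := fun t => (fos_hasDeriv α αf t).differentiableAt
  obtain ⟨t, ht, hmax⟩ := (isCompact_Icc (a := (0:ℝ)) (b := 1)).exists_isMaxOn
    (nonempty_Icc.2 zero_le_one) hd.continuous.continuousOn
  have hmax' : ∀ y ∈ Icc (0:ℝ) 1, FOS 1 α αf y ≤ FOS 1 α αf t := fun y hy => hmax hy
  refine ⟨t, ht, hmax', ?_⟩
  have hmono : MonotoneOn (FOS 1 α αf) (Iic 0) := by
    apply monotoneOn_of_deriv_nonneg (convex_Iic 0) hd.continuous.continuousOn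
      hd.differentiableOn
    intro x hx
    have hx : x ≤ 0 := mem_Iic.1 (interior_subset hx)
    rw [(fos_hasDeriv α αf x).deriv]
    have := Real.exp_pos (-((α + αf) * Real.exp (-((α + αf) * x))))
    apply mul_nonneg (by positivity) (by linarith)
  have hanti : AntitoneOn (FOS 1 α αf) (Ici 1) := by
    apply antitoneOn_of_deriv_nonpos (convex_Ici 1) hd.continuous.continuousOn
      hd.differentiableOn
    intro x hx
    have hx : 1 ≤ x := mem_Ici.1 (interior_subset hx)
    rw [(fos_hasDeriv α αf x).deriv]
    have : Real.exp (-((α + αf) * Real.exp (-((α + αf) * x)))) ≤ 1 := by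
      apply Real.exp_le_one_iff.2
      have := mul_pos hs (Real.exp_pos (-((α + αf) * x)))
      linarith
    apply mul_nonpos_of_nonneg_of_nonpos (by positivity) (by linarith)
  have hglob : ∀ y, FOS 1 α αf y ≤ FOS 1 α αf t := by
    intro y
    rcases le_total y 0 with h | h
    · exact (hmono h (mem_Iic.2 le_rfl) h).trans (hmax' 0 (by simp))
    · rcases le_total y 1 with h1 | h1
      · exact hmax' y ⟨h, h1⟩
      · exact (hanti (mem_Ici.2 le_rfl) h1 h1).trans (hmax' 1 (by simp))
  have hloc : IsLocalMax (FOS 1 α αf) t := Filter.Eventually.of_forall hglob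
  have h := hloc.hasDerivAt_eq_zero (fos_hasDeriv α αf t)
  have hp : (α + αf)^2 * Real.exp (-((α + αf) * t)) ≠ 0 := by positivity
  have := (mul_eq_zero.1 h).resolve_left hp
  linarith

theorem fts_diag (α t : ℝ) : FTS 1 α α t t = FOS 1 α α t := by
  have h1 : M1 1 α α = α + α := by unfold M1; ring
  have h2 : M2 1 α α = α + α := by unfold M2; ring
  rw [fos_one]
  unfold FTS
  rw [h1, h2]
  have e1 : ∀ z : ℝ, -(2*α*(1 - 1/2) * z) - (α + α)*(1/2) * z = -((α + α) * z) := by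
    intro z; ring
  have e2 : ∀ z : ℝ, -((α + α)*(1 - 1/2) * z) - α*1 * z = -((α + α) * z) := by
    intro z; ring
  rw [e1, e2]; ring

theorem fts_gt (α αf t : ℝ) (hne : α ≠ αf)
    (ht : Real.exp (-((α + αf) * Real.exp (-((α + αf) * t)))) = t) :
    FOS 1 α αf t < FTS 1 α αf t t := by
  have htpos : 0 < t := ht ▸ Real.exp_pos _
  rw [fos_one, ht]
  have h1 : M1 1 α αf = (3*α + αf)/2 := by unfold M1; ring
  have h2 : M2 1 α αf = (α + 3*αf)/2 := by unfold M2; ring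
  unfold FTS
  rw [h1, h2]
  have hxy : Real.exp (-((3*α + αf)/2 * t)) * Real.exp (-((α + 3*αf)/2 * t))
      = Real.exp (-((α + αf) * t))^2 := by
    rw [← Real.exp_add, ← Real.exp_nat_mul]; congr 1; push_cast; ring
  have hn : Real.exp (-((3*α + αf)/2 * t)) ≠ Real.exp (-((α + 3*αf)/2 * t)) := by
    intro h
    have h := Real.exp_injective h
    apply hne
    have : (α - αf) * t = 0 := by linarith
    have := (mul_eq_zero.1 this).resolve_right htpos.ne'
    linarith
  have key : ∀ E : ℝ, t * (E + (α + αf) * Real.exp (-((α + αf) * t)) + 1) ≤ Real.exp E := by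
    intro E
    have h := Real.add_one_le_exp (E + (α + αf) * Real.exp (-((α + αf) * t)))
    have e : Real.exp E = t * Real.exp (E + (α + αf) * Real.exp (-((α + αf) * t))) := by
      nth_rewrite 1 [← ht]
      rw [← Real.exp_add]; congr 1; ring
    rw [e]
    exact mul_le_mul_of_nonneg_left h htpos.le
  have hx := Real.exp_pos (-((3*α + αf)/2 * t))
  have hy := Real.exp_pos (-((α + 3*αf)/2 * t))
  have hz := Real.exp_pos (-((α + αf) * t))
  generalize Real.exp (-((3*α + αf)/2 * t)) = x at *
  generalize Real.exp (-((α + 3*αf)/2 * t)) = y at *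
  generalize Real.exp (-((α + αf) * t)) = z at *
  have hlt : 2 * z < x + y := by
    have := sq_pos_of_ne_zero (sub_ne_zero.2 hn)
    nlinarith
  have k1 := key (-(2*α*(1 - 1/2) * x) - (α + αf)*(1/2) * y)
  have k2 := key (-((α + αf)*(1 - 1/2) * x) - αf*1 * y)
  linarith

theorem fts_le_max (α αf t : ℝ) (ht : t ∈ Icc (0:ℝ) 1) : FTS 1 α αf t t ≤ maxTS 1 α αf := by
  have hc : Continuous (fun p : ℝ × ℝ => FTS 1 α αf p.1 p.2) := by
    unfold FTS; fun_prop
  exact le_csSup ((isCompact_Icc.prod isCompact_Icc).image hc).bddAbove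
    ⟨(t, t), ⟨ht, ht⟩, rfl⟩

/-- At full budget `B = 1`, the one-sided allocation dominates:
`max F_TS ≥ max F_OS`, strictly when `α ≠ α_f`. -/
theorem full_budget_one_sided_dominance (α αf : ℝ) (hα : 0 ≤ α) (hαf : 0 ≤ αf) :
    maxOS 1 α αf ≤ maxTS 1 α αf ∧ (α ≠ αf → maxOS 1 α αf < maxTS 1 α αf) := by
  have hne : (FOS 1 α αf '' Icc 0 1).Nonempty := (nonempty_Icc.2 zero_le_one).image _
  have hstrict : α ≠ αf → maxOS 1 α αf < maxTS 1 α αf := by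
    intro h
    have hs : 0 < α + αf := by
      rcases hα.eq_or_lt with h0 | h0
      · rcases hαf.eq_or_lt with h1 | h1
        · exact absurd (h0.symm.trans h1) h
        · linarith
      · linarith
    obtain ⟨t, ht, hm, hc⟩ := fos_crit α αf hs
    have : maxOS 1 α αf ≤ FOS 1 α αf t := by
      apply csSup_le hne
      rintro _ ⟨y, hy, rfl⟩
      exact hm y hy
    exact this.trans_lt ((fts_gt α αf t h hc).trans_le (fts_le_max α αf t ht))
  refine ⟨?_, hstrict⟩
  by_cases h : α = αf
  · subst h
    apply csSup_le hne
    rintro _ ⟨y, hy, rfl⟩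
    rw [← fts_diag]
    exact fts_le_max α α y hy
  · exact (hstrict h).le
end

section
/- Fix α = 0 and B ∈ (0,1). There exists a threshold A(B) > 0 such that for all α_f > A(B), max_{(t₁,t₂)∈[0,1]²} F_TS(t₁,t₂) > max_{t₁∈[0,1]} F_OS(t₁). (Equivalently, the one-sided matching rate strictly exceeds the two-sided matching rate: η_OS(B,0,α_f) > η_TS(B,0,α_f) for all sufficiently large α_f.) -/
open Set

lemma fos_bound (B a t : ℝ) (hB0 : 0 < B) (hB1 : B < 1) (ht : 0 ≤ t)
    (ha : 256 / (B * (1 - B)^2) < a) :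
    FOS B 0 a t ≤ 1 - B + B * Real.exp (-(a * (1 - B/4))) := by
  have h1B : 0 < 1 - B := by linarith
  have ha0 : 0 < a := lt_trans (by positivity) ha
  have hab : 256 < a * (B * (1 - B)^2) := by
    rwa [div_lt_iff₀ (by positivity)] at ha
  obtain ⟨x, hx⟩ : ∃ x, x = a * B * t := ⟨_, rfl⟩
  have hx0 : 0 ≤ x := by rw [hx]; positivity
  obtain ⟨s, hs⟩ : ∃ s, s = Real.exp (-(x/2)) := ⟨_, rfl⟩
  have hs0 : 0 < s := by rw [hs]; positivity
  have hs1 : s ≤ 1 := by rw [hs]; exact Real.exp_le_one_iff.2 (by linarith)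
  have hu : Real.exp (-x) = s^2 := by
    rw [hs, ← Real.exp_nat_mul]; congr 1; push_cast; ring
  have hF : FOS B 0 a t = -B + B * Real.exp (-(a * s^2)) + s^2 * (1 + x) := by
    have hm : Mos B 0 a * t = x := by rw [hx]; unfold Mos; ring
    unfold FOS
    rw [hm, hu]
    simp
    ring
  have hsx : s * (1 + x/2) ≤ 1 := by
    have h1 := Real.add_one_le_exp (x/2)
    have h2 : s * Real.exp (x/2) = 1 := by
      rw [hs, ← Real.exp_add]; simp
    nlinarith
  have hkey : s^2 * (1 + x) ≤ 1 - (1 - s)^2 := by nlinarith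
  have hpos := Real.exp_pos (-(a * (1 - B/4)))
  rw [hF]
  by_cases hc : 1 - B/4 ≤ s^2
  · have : Real.exp (-(a * s^2)) ≤ Real.exp (-(a * (1 - B/4))) := by
      apply Real.exp_le_exp.2
      nlinarith
    nlinarith [sq_nonneg (1 - s)]
  · push Not at hc
    have hmain : B * Real.exp (-(a * s^2)) ≤ (1 - s)^2 := by
      by_cases hd : s ≤ (1 - B)/2
      · have : Real.exp (-(a * s^2)) ≤ 1 := Real.exp_le_one_iff.2 (by nlinarith [mul_nonneg ha0.le (sq_nonneg s)])
        nlinarith [sq_nonneg s]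
      · push Not at hd
        have h1 : B / 8 ≤ 1 - s := by nlinarith
        have h2 : B^2/64 ≤ (1-s)^2 := by nlinarith
        have h3 : ((1 - B)/2)^2 ≤ s^2 := by nlinarith
        have h4 := Real.add_one_le_exp (a * s^2)
        have h5 : Real.exp (-(a * s^2)) * Real.exp (a * s^2) = 1 := by
          rw [← Real.exp_add]; simp
        have h6 : 64 ≤ B * Real.exp (a * s^2) := by
          have : a * ((1 - B)/2)^2 ≤ a * s^2 := by gcongr
          have : B * (a * ((1 - B)/2)^2) ≤ B * Real.exp (a * s^2) := by
            gcongr; linarith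
          nlinarith
        have h7 : Real.exp (-(a * s^2)) * 64 ≤ B := by
          have := mul_le_mul_of_nonneg_left h6 (Real.exp_pos (-(a * s^2))).le
          nlinarith
        nlinarith
    nlinarith

lemma fts_bound (B a : ℝ) (hB0 : 0 < B) (hB1 : B < 1) (ha : 0 < a) :
    1 - B + B/2 * Real.exp (-(a * (1 - B/2)) - 1) ≤ FTS B 0 a 0 1 := by
  have hm : M2 B 0 a = (1 + B/2) * a := by unfold M2; ring
  obtain ⟨w, hw⟩ : ∃ w, w = Real.exp (-((1 + B/2) * a)) := ⟨_, rfl⟩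
  have hw0 : 0 < w := by rw [hw]; positivity
  have haw : a * w ≤ 1 := by
    have h1 := Real.add_one_le_exp ((1 + B/2) * a)
    have h2 : w * Real.exp ((1 + B/2) * a) = 1 := by
      rw [hw, ← Real.exp_add]; simp
    have : a ≤ Real.exp ((1 + B/2) * a) := by nlinarith
    nlinarith
  have hF : FTS B 0 a 0 1 = (1 - B/2) * Real.exp (-(a * (B/2) * w))
      + B/2 * Real.exp (-(a * (1 - B/2)) - a * B * w) + (1 - B/2)
      + B/2 * w * (1 + (1 + B/2) * a) - 1 := by
    unfold FTS
    rw [hm, mul_one, ← hw]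
    simp
  rw [hF]
  have h1 := Real.add_one_le_exp (-(a * (B/2) * w))
  have h2 : Real.exp (-(a * (1 - B/2)) - 1) ≤ Real.exp (-(a * (1 - B/2)) - a * B * w) := by
    apply Real.exp_le_exp.2
    nlinarith
  have h3 : (1 - B/2) * (-(a * (B/2) * w) + 1) ≤ (1 - B/2) * Real.exp (-(a * (B/2) * w)) := by
    apply mul_le_mul_of_nonneg_left h1; linarith
  have h4 : B/2 * Real.exp (-(a * (1 - B/2)) - 1) ≤ B/2 * Real.exp (-(a * (1 - B/2)) - a * B * w) := by
    gcongr
  have h5 : 0 ≤ B/2 * w * (1 + B * a) := by positivity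
  nlinarith

/-- One-sided dominance for `α = 0`: for any `B ∈ (0,1)` there is a threshold
`A(B) > 0` such that for all `α_f > A(B)`, `max F_TS > max F_OS`
(equivalently `η_OS > η_TS`). -/
theorem one_sided_dominance_alpha_zero (B : ℝ) (hB : B ∈ Ioo (0:ℝ) 1) :
    ∃ A : ℝ, 0 < A ∧ ∀ αf : ℝ, A < αf → maxOS B 0 αf < maxTS B 0 αf := by
  obtain ⟨hB0, hB1⟩ := hB
  have h1B : 0 < 1 - B := by linarith
  have p1 : 0 < 256 / (B * (1 - B)^2) := by positivity
  have p2 : 0 < 8 / B := by positivity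
  refine ⟨256 / (B * (1 - B)^2) + 8 / B, by positivity, fun a ha => ?_⟩
  have ha0 : 0 < a := by linarith
  have haB : 8 < a * B := by
    have : 8 / B < a := by linarith
    rwa [div_lt_iff₀ hB0] at this
  have hOS : maxOS B 0 a ≤ 1 - B + B * Real.exp (-(a * (1 - B/4))) := by
    apply csSup_le
    · exact (nonempty_Icc.2 zero_le_one).image _
    · rintro _ ⟨t, ht, rfl⟩
      exact fos_bound B a t hB0 hB1 ht.1 (by linarith)
  have hTS : FTS B 0 a 0 1 ≤ maxTS B 0 a := by
    apply le_csSup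
    · apply IsCompact.bddAbove
      apply (isCompact_Icc.prod isCompact_Icc).image
      unfold FTS
      fun_prop
    · exact ⟨(0, 1), by simp, rfl⟩
  have hlt : B * Real.exp (-(a * (1 - B/4))) < B/2 * Real.exp (-(a * (1 - B/2)) - 1) := by
    have e : Real.exp (-(a * (1 - B/2)) - 1) = Real.exp (-(a * (1 - B/4))) * Real.exp (a * B / 4 - 1) := by
      rw [← Real.exp_add]; congr 1; ring
    rw [e]
    have h1 := Real.add_one_lt_exp (x := a * B / 4 - 1) (by linarith)
    have h2 : 2 < Real.exp (a * B / 4 - 1) := by linarith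
    have := Real.exp_pos (-(a * (1 - B/4)))
    have := mul_lt_mul_of_pos_left h2 (mul_pos hB0 this)
    nlinarith
  linarith [fts_bound B a hB0 hB1 ha0]
end

section
/- Let B* = 2 − 2e/3. For any B ∈ [B*, 1) and any α > 0, there exists a threshold A(α,B) > 0 such that for all α_f > A(α,B), max_{t₁∈[0,1]} F_OS(t₁) > max_{(t₁,t₂)∈[0,1]²} F_TS(t₁,t₂). (Equivalently, the two-sided matching rate strictly exceeds the one-sided matching rate: η_TS(B,α,α_f) > η_OS(B,α,α_f) for all sufficiently large α_f.) -/
open Set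

/-- Monotonicity auxiliary: sign of `1 - q - exp (1 - exp q)`. -/
lemma aux_r_antitone : Antitone (fun q : ℝ => 1 - q - Real.exp (1 - Real.exp q)) := by
  have hd : ∀ q : ℝ, HasDerivAt (fun q : ℝ => 1 - q - Real.exp (1 - Real.exp q))
      (0 - 1 - Real.exp (1 - Real.exp q) * (0 - Real.exp q)) q := by
    intro q
    exact ((hasDerivAt_const q (1:ℝ)).sub (hasDerivAt_id q)).sub
      (((hasDerivAt_const q (1:ℝ)).sub (Real.hasDerivAt_exp q)).exp)
  apply antitone_of_deriv_nonpos
  · intro q; exact (hd q).differentiableAt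
  · intro q
    rw [(hd q).deriv]
    have h1 : Real.exp (1 - Real.exp q) * Real.exp q = Real.exp (1 - Real.exp q + q) :=
      (Real.exp_add _ _).symm
    have h2 : Real.exp (1 - Real.exp q + q) ≤ 1 := by
      rw [Real.exp_le_one_iff]
      linarith [Real.add_one_le_exp q]
    nlinarith

lemma aux_K (q : ℝ) : Real.exp (1 - Real.exp q) + Real.exp q * (2 - q) ≤ 3 := by
  set f : ℝ → ℝ := fun q => Real.exp (1 - Real.exp q) + Real.exp q * (2 - q) with hf
  have hd : ∀ q : ℝ, HasDerivAt f
      (Real.exp q * (1 - q - Real.exp (1 - Real.exp q))) q := by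
    intro q
    have := (((hasDerivAt_const q (1:ℝ)).sub (Real.hasDerivAt_exp q)).exp).add
      ((Real.hasDerivAt_exp q).mul ((hasDerivAt_const q (2:ℝ)).sub (hasDerivAt_id q)))
    refine this.congr_deriv ?_
    simp
    ring
  have hcont : Continuous f := continuous_iff_continuousAt.2 fun q => (hd q).continuousAt
  have h0 : f 0 = 3 := by simp [hf]; norm_num
  have r0 : (fun q : ℝ => 1 - q - Real.exp (1 - Real.exp q)) 0 = 0 := by simp
  change f q ≤ 3
  rw [← h0]
  rcases le_total q 0 with h | h
  · have : MonotoneOn f (Iic 0) := by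
      apply monotoneOn_of_deriv_nonneg (convex_Iic 0) hcont.continuousOn
      · intro x _; exact (hd x).differentiableAt.differentiableWithinAt
      · intro x hx
        rw [interior_Iic] at hx
        rw [(hd x).deriv]
        have := aux_r_antitone (le_of_lt hx)
        rw [r0] at this
        exact mul_nonneg (Real.exp_pos x).le this
    exact this h (by simp) h
  · have : AntitoneOn f (Ici 0) := by
      apply antitoneOn_of_deriv_nonpos (convex_Ici 0) hcont.continuousOn
      · intro x _; exact (hd x).differentiableAt.differentiableWithinAt
      · intro x hx
        rw [interior_Ici] at hx
        rw [(hd x).deriv]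
        have := aux_r_antitone (le_of_lt hx)
        rw [r0] at this
        exact mul_nonpos_of_nonneg_of_nonpos (Real.exp_pos x).le this
    exact this (by simp) h h

lemma aux_phi (L p : ℝ) (h0 : 0 ≤ L) (h1 : L ≤ 1) :
    Real.exp (-(L * Real.exp L * Real.exp (-p))) + Real.exp (-p) * (1 + p)
      ≤ Real.exp (-L) * (2 + L) := by
  obtain ⟨q, rfl⟩ : ∃ q, p = L - q := ⟨L - p, by ring⟩
  have e1 : Real.exp (-(L - q)) = Real.exp (-L) * Real.exp q := by
    rw [← Real.exp_add]; congr 1; ring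
  have e2 : Real.exp L * Real.exp (-L) = 1 := by rw [← Real.exp_add]; simp
  have e3 : Real.exp (-(L * Real.exp L * Real.exp (-(L - q))))
      = Real.exp (-L) * Real.exp (L * (1 - Real.exp q)) := by
    rw [← Real.exp_add, e1]; congr 1
    linear_combination (-L * Real.exp q) * e2
  rw [e3, e1]
  have hK := aux_K q
  set z := Real.exp q
  have hc : Real.exp (L * (1 - z)) ≤ L * Real.exp (1 - z) + (1 - L) := by
    have := convexOn_exp.2 (mem_univ (1 - z)) (mem_univ (0:ℝ)) h0 (sub_nonneg.2 h1) (by ring)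
    simpa using this
  have hw := Real.add_one_le_exp (1 - z)
  have : Real.exp (L * (1 - z)) + z * (1 + (L - q)) ≤ 2 + L := by
    nlinarith [mul_nonneg (sub_nonneg.2 h1) (sub_nonneg.2 hw)]
  have := mul_le_mul_of_nonneg_left this (Real.exp_pos (-L)).le
  linarith

lemma aux_h_le (p : ℝ) : Real.exp (-p) * (1 + p) ≤ 1 := by
  have h2 : Real.exp (-p) * Real.exp p = 1 := by rw [← Real.exp_add]; simp
  nlinarith [Real.add_one_le_exp p, Real.exp_pos (-p)]

lemma aux_h_small (ε : ℝ) (hε : 0 < ε) : ∃ P : ℝ, ∀ p, P ≤ p → Real.exp (-p) * (1 + p) ≤ ε := by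
  have t0 := Real.tendsto_pow_mul_exp_neg_atTop_nhds_zero 0
  have t1 := Real.tendsto_pow_mul_exp_neg_atTop_nhds_zero 1
  have t := t0.add t1
  rw [add_zero] at t
  obtain ⟨P, hP⟩ := Filter.eventually_atTop.1 (t.eventually (gt_mem_nhds hε))
  refine ⟨P, fun p hp => ?_⟩
  have := hP p hp
  simp only [pow_zero, pow_one] at this
  linarith

/-- Limit comparison. -/
lemma aux_limit (b α : ℝ) (hb0 : 0 < b) (hb1 : 2 * b < 1) (hb : (1 - b) * 3 ≤ Real.exp 1)
    (hα : 0 < α) :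
    ∃ T p₀ : ℝ, 0 ≤ T ∧ 0 ≤ p₀ ∧
      T < (1 - 2*b) * Real.exp (-(2*α * Real.exp (-p₀))) + Real.exp (-p₀) * (1 + p₀) - 1 ∧
      ∀ p, 0 ≤ p → (1 - b) * (Real.exp (-(2*α*(1-b) * Real.exp (-p)))
        + Real.exp (-p) * (1 + p)) - 1 ≤ T := by
  have hbpos : 0 < 1 - b := by linarith
  have hpos1 : 0 < (1 - 2*b) * Real.exp (-(2*α * Real.exp (-0)))
      + Real.exp (-0) * (1 + 0) - 1 := by
    have := mul_pos (by linarith : 0 < 1 - 2*b) (Real.exp_pos (-(2*α * Real.exp (-0))))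
    simp at this ⊢
    linarith
  rcases le_total (Real.exp 1) (2*α*(1-b)) with hu | hu
  · refine ⟨0, 0, le_rfl, le_rfl, hpos1, fun p _ => ?_⟩
    have h := aux_phi 1 p zero_le_one le_rfl
    have h2 : Real.exp (-(2*α*(1-b) * Real.exp (-p)))
        ≤ Real.exp (-(1 * Real.exp 1 * Real.exp (-p))) := by
      apply Real.exp_le_exp.2
      have := mul_le_mul_of_nonneg_right hu (Real.exp_pos (-p)).le
      linarith
    have e2 : Real.exp 1 * Real.exp (-1) = 1 := by rw [← Real.exp_add]; simp
    have h3 : (1 - b) * 3 * Real.exp (-1) ≤ 1 := by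
      have := mul_le_mul_of_nonneg_right hb (Real.exp_pos (-1)).le
      linarith
    have h4 := mul_le_mul_of_nonneg_left (add_le_add_left h2 (Real.exp (-p) * (1 + p))) hbpos.le
    have h5 := mul_le_mul_of_nonneg_left h hbpos.le
    linarith
  · have hiv : 2*α*(1-b) ∈ (fun L : ℝ => L * Real.exp L) '' Icc 0 1 := by
      apply intermediate_value_Icc zero_le_one (by fun_prop)
      constructor
      · simp; positivity
      · simpa using hu
    obtain ⟨L, ⟨hL0, hL1⟩, hL⟩ := hiv
    simp only at hL
    have hLpos : 0 < L := by
      rcases hL0.lt_or_eq with h | h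
      · exact h
      · exfalso
        rw [← h] at hL
        have : 0 < 2*α*(1-b) := by positivity
        simp at hL
        rcases hL with h | h <;> linarith
    set V := (1 - b) * (Real.exp (-L) * (2 + L)) - 1 with hV
    have hall : ∀ p, 0 ≤ p → (1 - b) * (Real.exp (-(2*α*(1-b) * Real.exp (-p)))
        + Real.exp (-p) * (1 + p)) - 1 ≤ V := by
      intro p _
      rw [← hL]
      have := mul_le_mul_of_nonneg_left (aux_phi L p hL0 hL1) hbpos.le
      linarith
    rcases le_total V 0 with h | h
    · exact ⟨0, 0, le_rfl, le_rfl, hpos1, fun p hp => (hall p hp).trans h⟩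
    · refine ⟨V, L, h, hL0, ?_, hall⟩
      have e2 : Real.exp L * Real.exp (-L) = 1 := by rw [← Real.exp_add]; simp
      have e3 : 2*α * Real.exp (-L) = L + b / (1-b) * L := by
        field_simp
        linear_combination (-Real.exp (-L)) * hL + L * e2
      have e4 : Real.exp (-(2*α * Real.exp (-L)))
          = Real.exp (-L) * Real.exp (-(b / (1-b) * L)) := by
        rw [← Real.exp_add, e3]; congr 1; ring
      rw [e4, hV]
      have h5 := Real.add_one_le_exp (-(b / (1-b) * L))
      have h6 : 0 < (1-2*b) * (-(b/(1-b) * L) + 1) + 1 + L - (1-b)*(2+L) := by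
        have : (1-2*b) * (-(b/(1-b) * L) + 1) + 1 + L - (1-b)*(2+L) = b^2 * L / (1-b) := by
          field_simp; ring
        rw [this]; positivity
      have h7 := mul_le_mul_of_nonneg_left h5 (by linarith : 0 ≤ 1 - 2*b)
      have h8 := mul_pos (Real.exp_pos (-L)) (lt_of_lt_of_le h6
        (by linarith : _ ≤ (1-2*b) * Real.exp (-(b/(1-b)*L)) + 1 + L - (1-b)*(2+L)))
      linarith

/-- Uniform upper bound for the two-sided objective. -/
lemma aux_upper (b α T ε : ℝ) (hb0 : 0 < b) (hb1 : 2 * b < 1) (hα : 0 < α) (hε : 0 < ε)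
    (hT : 0 ≤ T)
    (hall : ∀ p, 0 ≤ p → (1 - b) * (Real.exp (-(2*α*(1-b) * Real.exp (-p)))
        + Real.exp (-p) * (1 + p)) - 1 ≤ T) :
    ∃ A : ℝ, 0 < A ∧ ∀ αf, A < αf → ∀ p r, 0 ≤ p → 0 ≤ r →
      (1 - b) * Real.exp (-(2*α*(1-b) * Real.exp (-p)) - (α+αf)*b * Real.exp (-r))
      + b * Real.exp (-((α+αf)*(1-b) * Real.exp (-p)) - αf*(2*b) * Real.exp (-r))
      + (1 - b) * Real.exp (-p) * (1 + p) + b * Real.exp (-r) * (1 + r) - 1 ≤ T + 2 * ε := by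
  obtain ⟨P, hP⟩ := aux_h_small ε hε
  obtain ⟨N, hN⟩ := Filter.eventually_atTop.1
    ((Real.tendsto_exp_neg_atTop_nhds_zero).eventually (gt_mem_nhds hε))
  refine ⟨max 1 (N / (b * Real.exp (-P))), lt_of_lt_of_le one_pos (le_max_left _ _), ?_⟩
  intro αf hαf p r hp hr
  have hαf1 : 1 < αf := lt_of_le_of_lt (le_max_left _ _) hαf
  have hαf2 : N < αf * (b * Real.exp (-P)) :=
    (div_lt_iff₀ (by positivity)).1 (lt_of_le_of_lt (le_max_right _ _) hαf)
  have hbpos : 0 < 1 - b := by linarith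
  have key : ∀ c s : ℝ, αf * b ≤ c → s ≤ P → Real.exp (-(c * Real.exp (-s))) ≤ ε := by
    intro c s hc hs
    refine (hN _ ?_).le
    have h1 : Real.exp (-P) ≤ Real.exp (-s) := Real.exp_le_exp.2 (by linarith)
    have h2 : αf * b * Real.exp (-P) ≤ c * Real.exp (-s) := by
      apply mul_le_mul hc h1 (Real.exp_pos _).le
      exact le_trans (by positivity) hc
    linarith
  set X1 := Real.exp (-(2*α*(1-b) * Real.exp (-p)) - (α+αf)*b * Real.exp (-r))
  set X2 := Real.exp (-((α+αf)*(1-b) * Real.exp (-p)) - αf*(2*b) * Real.exp (-r))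
  have a1 : 0 ≤ 2*α*(1-b) * Real.exp (-p) := by positivity
  have a2 : 0 ≤ (α+αf)*b * Real.exp (-r) := by positivity
  have a3 : 0 ≤ (α+αf)*(1-b) * Real.exp (-p) := by positivity
  have a4 : 0 ≤ αf*(2*b) * Real.exp (-r) := by positivity
  have x1a : X1 ≤ Real.exp (-(2*α*(1-b) * Real.exp (-p))) := Real.exp_le_exp.2 (by linarith)
  have x1b : X1 ≤ Real.exp (-((α+αf)*b * Real.exp (-r))) := Real.exp_le_exp.2 (by linarith)
  have x1c : X1 ≤ 1 := Real.exp_le_one_iff.2 (by linarith)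
  have x2a : X2 ≤ Real.exp (-((α+αf)*(1-b) * Real.exp (-p))) := Real.exp_le_exp.2 (by linarith)
  have x2c : X2 ≤ 1 := Real.exp_le_one_iff.2 (by linarith)
  have hhp := aux_h_le p
  have hhr := aux_h_le r
  have hTp := hall p hp
  rw [mul_assoc (1-b) (Real.exp (-p)), mul_assoc b (Real.exp (-r))]
  set H1 := Real.exp (-p) * (1 + p)
  set H2 := Real.exp (-r) * (1 + r)
  have c1 : αf * b ≤ (α+αf)*b := by nlinarith
  have c2 : αf * b ≤ (α+αf)*(1-b) := by nlinarith
  -- combine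
  have comb : ∀ u1 u2 u3 u4 : ℝ, X1 ≤ u1 → X2 ≤ u2 → H1 ≤ u3 → H2 ≤ u4 →
      (1 - b) * u1 + b * u2 + (1 - b) * u3 + b * u4 - 1 ≤ T + 2 * ε →
      (1 - b) * X1 + b * X2 + (1 - b) * H1 + b * H2 - 1 ≤ T + 2 * ε := by
    intro u1 u2 u3 u4 h1 h2 h3 h4 h
    have := mul_le_mul_of_nonneg_left h1 hbpos.le
    have := mul_le_mul_of_nonneg_left h2 hb0.le
    have := mul_le_mul_of_nonneg_left h3 hbpos.le
    have := mul_le_mul_of_nonneg_left h4 hb0.le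
    linarith
  have hbε : 0 < b * ε := by positivity
  have hbε' : 0 < (1 - b) * ε := by positivity
  rcases le_total r P with hrP | hrP
  · have k1 := x1b.trans (key _ r c1 hrP)
    rcases le_total p P with hpP | hpP
    · have k2 := x2a.trans (key _ p c2 hpP)
      exact comb _ _ _ _ k1 k2 hhp hhr (by linarith)
    · exact comb _ _ _ _ k1 x2c (hP p hpP) hhr (by linarith)
  · rcases le_total p P with hpP | hpP
    · have k2 := x2a.trans (key _ p c2 hpP)
      exact comb _ _ _ _ x1a k2 le_rfl (hP r hrP) (by linarith)
    · exact comb _ _ _ _ x1c x2c (hP p hpP) (hP r hrP) (by linarith)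

/-- Two-sided dominance for `B ∈ [B*, 1)` with `B* = 2 − 2e/3`: for any `α > 0`
there is a threshold `A(α,B) > 0` such that for all `α_f > A(α,B)`,
`max F_OS > max F_TS` (equivalently `η_TS > η_OS`). -/
theorem two_sided_dominance_large_budget (B α : ℝ)
    (hBlow : 2 - 2 * Real.exp 1 / 3 ≤ B) (hBhigh : B < 1) (hα : 0 < α) :
    ∃ A : ℝ, 0 < A ∧ ∀ αf : ℝ, A < αf → maxTS B α αf < maxOS B α αf := by
  obtain ⟨b, rfl⟩ : ∃ b, B = 2 * b := ⟨B / 2, by ring⟩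
  have hb0 : 0 < b := by linarith [Real.exp_one_lt_d9]
  obtain ⟨T, p₀, hT, hp₀, hgap, hall⟩ := aux_limit b α hb0 hBhigh (by linarith) hα
  set G := (1 - 2*b) * Real.exp (-(2*α * Real.exp (-p₀))) + Real.exp (-p₀) * (1 + p₀) - 1 with hG
  obtain ⟨A, hA, hub⟩ := aux_upper b α T ((G - T)/4) hb0 hBhigh hα (by linarith) hT hall
  refine ⟨max A (α + p₀ / (2*b)), lt_of_lt_of_le hA (le_max_left _ _), fun αf hαf => ?_⟩
  have h1 : A < αf := lt_of_le_of_lt (le_max_left _ _) hαf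
  have h2 : p₀ / (2*b) < αf - α := by
    have := lt_of_le_of_lt (le_max_right _ _) hαf
    linarith
  have h3 : p₀ < (αf - α) * (2*b) := (div_lt_iff₀ (by positivity)).1 h2
  have hαf0 : 0 < αf := hA.trans h1
  have hMpos : 0 < Mos (2*b) α αf := by unfold Mos; linarith
  have hMp : p₀ ≤ Mos (2*b) α αf := by unfold Mos; linarith
  have e : 2 * b / 2 = b := by ring
  have hTS : maxTS (2*b) α αf ≤ T + 2 * ((G - T)/4) := by
    unfold maxTS
    apply csSup_le
    · exact ⟨_, (0, 0), by simp, rfl⟩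
    · rintro _ ⟨⟨t₁, t₂⟩, ⟨⟨ht1, _⟩, ⟨ht2, _⟩⟩, rfl⟩
      simp only at ht1 ht2
      have m1 : 0 ≤ M1 (2*b) α αf * t₁ := by
        apply mul_nonneg _ ht1
        unfold M1; rw [e]
        have : 0 < 2 - b := by linarith
        positivity
      have m2 : 0 ≤ M2 (2*b) α αf * t₂ := by
        apply mul_nonneg _ ht2
        unfold M2; rw [e]
        have : 0 < 1 - b := by linarith
        positivity
      have := hub αf h1 _ _ m1 m2
      simp only [FTS, e]
      exact this
  have hOS : G ≤ maxOS (2*b) α αf := by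
    have hle : G ≤ FOS (2*b) α αf (p₀ / Mos (2*b) α αf) := by
      unfold FOS
      rw [mul_div_cancel₀ _ hMpos.ne']
      have := mul_pos (by positivity : 0 < 2*b) (Real.exp_pos (-((α + αf) * Real.exp (-p₀))))
      linarith
    refine hle.trans (le_csSup ?_ ⟨_, ⟨by positivity, (div_le_one hMpos).2 hMp⟩, rfl⟩)
    apply (isCompact_Icc.image _).bddAbove
    unfold FOS
    fun_prop
  linarith
end

section
/- Fix B ∈ (0,1). There exists α₀(B) > 0 such that for every α > α₀(B), there exists a threshold A(α,B) > 0 such that for all α_f > A(α,B), max_{t₁∈[0,1]} F_OS(t₁) > max_{(t₁,t₂)∈[0,1]²} F_TS(t₁,t₂). (Equivalently, in the large-α regime the two-sided matching rate strictly exceeds the one-sided matching rate for all sufficiently large α_f.) -/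
open Set

lemma aux_small (e : ℝ) (he : 0 < e) :
    ∃ d : ℝ, 0 < d ∧ ∀ x : ℝ, 0 < x → x < d → x + Real.negMulLog x ≤ e := by
  have hc : ContinuousAt (fun x : ℝ => x + Real.negMulLog x) 0 :=
    (continuous_id.add Real.continuous_negMulLog).continuousAt
  obtain ⟨d, hd, h⟩ := Metric.continuousAt_iff.1 hc e he
  refine ⟨d, hd, fun x hx hxd => ?_⟩
  have h1 := @h x (by rw [Real.dist_eq, sub_zero, abs_of_pos hx]; exact hxd)
  simp only [Real.dist_eq, Real.negMulLog_zero, add_zero, sub_zero] at h1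
  exact (le_abs_self _).trans h1.le

lemma aux_h_le_s4 (x : ℝ) (hx : 0 < x) : x + Real.negMulLog x ≤ 1 := by
  have h := Real.one_sub_inv_le_log_of_pos hx
  have h2 := mul_le_mul_of_nonneg_left h hx.le
  have h3 : x * (1 - x⁻¹) = x - 1 := by field_simp
  unfold Real.negMulLog
  linarith

lemma aux_exp (z e : ℝ) (he : 0 < e) (h : 1 / e ≤ z) : Real.exp (-z) ≤ e := by
  rw [Real.exp_neg]
  have h1 : 1 / e ≤ Real.exp z := by linarith [Real.add_one_le_exp z]
  rw [inv_le_comm₀ (Real.exp_pos z) he]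
  simpa using h1

lemma aux_h_exp (s : ℝ) :
    Real.exp (-s) * (1 + s) = Real.exp (-s) + Real.negMulLog (Real.exp (-s)) := by
  unfold Real.negMulLog
  rw [Real.log_exp]; ring

/-- The core bound on the two-sided objective in the variables `x = e^{-M₁t₁}`, `y = e^{-M₂t₂}`. -/
lemma aux_core (b α K ε δ x y : ℝ) (hb : 0 < b) (hb2 : b < 1 / 2) (hα : 0 < α) (hK : 0 < K)
    (hε : 0 < ε) (hδ : 0 < δ) (hx : 0 < x) (hy : 0 < y)
    (hsm : ∀ x : ℝ, 0 < x → x < δ → x + Real.negMulLog x ≤ ε / 2)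
    (hlarge : Real.exp (-(2 * α * (1 - b) * x)) + (x + Real.negMulLog x) ≤ 1 + b)
    (hKe : Real.exp (-(K * b * δ)) ≤ ε / 2) :
    (1 - b) * Real.exp (-(2 * α * (1 - b) * x) - (α + K) * b * y)
      + b * Real.exp (-((α + K) * (1 - b) * x) - K * (2 * b) * y)
      + (1 - b) * (x + Real.negMulLog x) + b * (y + Real.negMulLog y) - 1 ≤ ε := by
  have hhx := aux_h_le_s4 x hx
  have hhy := aux_h_le_s4 y hy
  have hb1 : 0 < 1 - b := by linarith
  have p1 : 0 < 2 * α * (1 - b) * x := by positivity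
  have p2 : 0 < α * b * y := by positivity
  have p3 : 0 < K * b * y := by positivity
  have p4 : 0 < α * (1 - b) * x := by positivity
  have p5 : 0 < K * (1 - b) * x := by positivity
  set E1 := Real.exp (-(2 * α * (1 - b) * x) - (α + K) * b * y) with hE1
  set E2 := Real.exp (-((α + K) * (1 - b) * x) - K * (2 * b) * y) with hE2
  set H := x + Real.negMulLog x
  set G := y + Real.negMulLog y
  rcases le_or_gt δ y with hyd | hyd
  · have q : K * b * δ ≤ K * b * y := mul_le_mul_of_nonneg_left hyd (by positivity)
    have h1 : E1 ≤ ε / 2 := (Real.exp_le_exp.2 (by nlinarith)).trans hKe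
    have h2 : E2 ≤ ε / 2 := (Real.exp_le_exp.2 (by nlinarith)).trans hKe
    nlinarith
  · have hG := hsm y hy hyd
    rcases le_or_gt δ x with hxd | hxd
    · have q : K * b * δ ≤ K * (1 - b) * x := by
        apply mul_le_mul _ hxd hδ.le (by positivity)
        exact mul_le_mul_of_nonneg_left (by linarith) hK.le
      have h1 : E1 ≤ Real.exp (-(2 * α * (1 - b) * x)) := Real.exp_le_exp.2 (by nlinarith)
      have h2 : E2 ≤ ε / 2 := (Real.exp_le_exp.2 (by nlinarith)).trans hKe
      have h3 : E1 + H ≤ 1 + b := by linarith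
      have h4 := mul_le_mul_of_nonneg_left h3 hb1.le
      nlinarith
    · have hH := hsm x hx hxd
      have h1 : E1 ≤ 1 := Real.exp_le_one_iff.2 (by nlinarith)
      have h2 : E2 ≤ 1 := Real.exp_le_one_iff.2 (by nlinarith)
      nlinarith

/-- Two-sided dominance in the large-`α` regime: for any `B ∈ (0,1)` there exists
`α₀(B) > 0` such that for every `α > α₀(B)` there is a threshold `A(α,B) > 0`
with `max F_OS > max F_TS` for all `α_f > A(α,B)`. -/
theorem two_sided_dominance_large_alpha (B : ℝ) (hB : B ∈ Ioo (0:ℝ) 1) :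
    ∃ α₀ : ℝ, 0 < α₀ ∧
      ∀ α : ℝ, α₀ < α →
        ∃ A : ℝ, 0 < A ∧ ∀ αf : ℝ, A < αf → maxTS B α αf < maxOS B α αf := by
  obtain ⟨hB0, hB1⟩ := hB
  obtain ⟨x0, hx0, hsm0⟩ := aux_small (B / 2) (by linarith)
  have hb1 : 0 < 1 - B / 2 := by linarith
  refine ⟨1 / (B / 2) / (2 * (1 - B / 2) * x0), by positivity, fun α hα => ?_⟩
  have hα0 : 0 < α := lt_trans (by positivity) hα
  rw [div_lt_iff₀ (by positivity)] at hα
  set ε := (1 - B) * Real.exp (-(2 * α)) with hε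
  have hε0 : 0 < ε := mul_pos (by linarith) (Real.exp_pos _)
  obtain ⟨δ, hδ, hsm⟩ := aux_small (ε / 2) (by linarith)
  refine ⟨1 / (ε / 2) / (B / 2 * δ), by positivity, fun K hK => ?_⟩
  have hK0 : 0 < K := lt_trans (by positivity) hK
  rw [div_lt_iff₀ (by positivity)] at hK
  have hKe : Real.exp (-(K * (B / 2) * δ)) ≤ ε / 2 :=
    aux_exp _ _ (by linarith) (by nlinarith)
  have hTS : maxTS B α K ≤ ε := by
    apply csSup_le
    · exact ⟨_, ⟨(0, 0), by simp, rfl⟩⟩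
    rintro _ ⟨⟨t, s⟩, -, rfl⟩
    have hx := Real.exp_pos (-(M1 B α K * t))
    have hy := Real.exp_pos (-(M2 B α K * s))
    have key := aux_core (B / 2) α K ε δ _ _ (by linarith) (by linarith) hα0 hK0 hε0 hδ hx hy hsm
      (by
        rcases lt_or_ge (Real.exp (-(M1 B α K * t))) x0 with h | h
        · have h1 := hsm0 _ hx h
          have h2 : Real.exp (-(2 * α * (1 - B / 2) * Real.exp (-(M1 B α K * t)))) ≤ 1 :=
            Real.exp_le_one_iff.2 (by
              have : 0 < 2 * α * (1 - B / 2) * Real.exp (-(M1 B α K * t)) := by positivity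
              linarith)
          linarith
        · have h1 := aux_h_le_s4 _ hx
          have h3 : 2 * α * (1 - B / 2) * x0
              ≤ 2 * α * (1 - B / 2) * Real.exp (-(M1 B α K * t)) :=
            mul_le_mul_of_nonneg_left h (by positivity)
          have h2 := aux_exp (2 * α * (1 - B / 2) * Real.exp (-(M1 B α K * t))) (B / 2)
            (by linarith) (by linarith)
          linarith) hKe
    rw [← aux_h_exp, ← aux_h_exp] at key
    have e1 : K * (2 * (B / 2)) = K * B := by ring
    rw [e1] at key
    simp only [FTS]
    linarith
  have hOS : FOS B α K 0 ≤ maxOS B α K := by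
    apply le_csSup
    · apply (isCompact_Icc.image _).bddAbove
      unfold FOS
      fun_prop
    · exact ⟨0, by simp, rfl⟩
  have h0 : ε < FOS B α K 0 := by
    have := mul_pos hB0 (Real.exp_pos (-(α + K)))
    simp only [FOS, mul_zero, neg_zero, Real.exp_zero, mul_one, add_zero]
    linarith
  linarith
end

section
/- Let B ∈ (0,1) and α ≥ 0. Then, as α_f → ∞, the quantity max_{t₁∈[0,1]} F_OS(t₁; B, α, α_f) converges to sup_{y∈(0,1]} Φ_OS(y), where Φ_OS(y) = (1−B)e^{−2αy} + y(1 − ln y) − 1; moreover this supremum is attained at some y ∈ (0,1]. -/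
open Set

/-- The limiting one-sided objective `Φ_OS(y) = (1−B)e^{−2αy} + y(1 − ln y) − 1`. -/
noncomputable def PhiOS (B α y : ℝ) : ℝ :=
  (1 - B) * Real.exp (-(2*α*y)) + y * (1 - Real.log y) - 1

/-- As `α_f → ∞`, `max_{t₁∈[0,1]} F_OS` converges to `sup_{y∈(0,1]} Φ_OS(y)`,
and this supremum is attained. -/
theorem limit_one_sided (B α : ℝ) (hB : B ∈ Ioo (0:ℝ) 1) (hα : 0 ≤ α) :
    Filter.Tendsto (fun αf => maxOS B α αf) Filter.atTop
      (nhds (sSup (PhiOS B α '' Ioc 0 1))) ∧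
    ∃ y ∈ Ioc (0:ℝ) 1, PhiOS B α y = sSup (PhiOS B α '' Ioc 0 1) := by
  obtain ⟨hB0, hB1⟩ := hB
  -- continuity of the limiting objective, and existence of a maximiser on `[0,1]`
  have hcont : Continuous (PhiOS B α) := by
    have h : PhiOS B α = fun y =>
        (1 - B) * Real.exp (-(2*α*y)) + (y + Real.negMulLog y) - 1 := by
      funext y
      simp only [PhiOS, Real.negMulLog]
      ring
    rw [h]
    have := Real.continuous_negMulLog
    fun_prop
  obtain ⟨y, hy, hmax⟩ := isCompact_Icc.exists_isMaxOn
    (nonempty_Icc.2 (zero_le_one (α := ℝ))) hcont.continuousOn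
  have hle : ∀ z ∈ Icc (0:ℝ) 1, PhiOS B α z ≤ PhiOS B α y := fun z hz => hmax hz
  have hP0 : PhiOS B α 0 = -B := by simp [PhiOS]
  have hP1 : 0 < PhiOS B α 1 := by
    have : PhiOS B α 1 = (1 - B) * Real.exp (-(2*α*1)) := by simp [PhiOS]
    rw [this]
    exact mul_pos (by linarith) (Real.exp_pos _)
  have hSpos : 0 < PhiOS B α y := lt_of_lt_of_le hP1 (hle 1 (by simp))
  have hy0 : 0 < y := by
    rcases eq_or_lt_of_le hy.1 with h | h
    · rw [← h, hP0] at hSpos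
      linarith
    · exact h
  have hyI : y ∈ Ioc (0:ℝ) 1 := ⟨hy0, hy.2⟩
  have hS : sSup (PhiOS B α '' Ioc 0 1) = PhiOS B α y := by
    apply IsGreatest.csSup_eq
    refine ⟨⟨y, hyI, rfl⟩, ?_⟩
    rintro _ ⟨z, hz, rfl⟩
    exact hle z ⟨hz.1.le, hz.2⟩
  refine ⟨?_, y, hyI, hS.symm⟩
  rw [hS]
  set S := PhiOS B α y with hSdef
  -- the objective in the variable `z = exp (-M t)`
  have hF : ∀ αf t, FOS B α αf t = PhiOS B α (Real.exp (-(Mos B α αf * t)))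
      + B * Real.exp (-((α + αf) * Real.exp (-(Mos B α αf * t)))) := by
    intro αf t
    simp only [FOS, PhiOS, Real.log_exp]
    ring
  -- near zero, `z (1 - log z)` is small
  obtain ⟨δ, hδ, hsmall⟩ : ∃ δ > 0, ∀ z : ℝ, 0 < z → z < δ →
      z * (1 - Real.log z) < S := by
    have hc : Continuous (fun z : ℝ => z + Real.negMulLog z) :=
      continuous_id.add Real.continuous_negMulLog
    have ht := hc.tendsto 0
    simp only [Real.negMulLog_zero, add_zero] at ht
    obtain ⟨δ, hδ, h⟩ := Metric.eventually_nhds_iff.1 (ht.eventually (gt_mem_nhds hSpos))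
    refine ⟨δ, hδ, fun z hz hzδ => ?_⟩
    have h1 := h (y := z) (by rw [Real.dist_eq, sub_zero, abs_of_pos hz]; exact hzδ)
    simp only [Real.negMulLog] at h1
    linarith
  have hMt : Filter.Tendsto (fun αf => Mos B α αf) Filter.atTop Filter.atTop := by
    unfold Mos
    apply Filter.tendsto_atTop_add_const_left
    apply Filter.Tendsto.atTop_mul_const hB0
    exact Filter.tendsto_atTop_add_const_right _ _ Filter.tendsto_id
  have hE : Filter.Tendsto (fun αf : ℝ => Real.exp (-((α + αf) * δ))) Filter.atTop
      (nhds 0) := by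
    apply Real.tendsto_exp_neg_atTop_nhds_zero.comp
    apply Filter.Tendsto.atTop_mul_const hδ
    exact Filter.tendsto_atTop_add_const_left _ _ Filter.tendsto_id
  have hupper : ∀ αf, 0 ≤ αf → 0 ≤ Mos B α αf → ∀ t ∈ Icc (0:ℝ) 1,
      FOS B α αf t ≤ S + Real.exp (-((α + αf) * δ)) := by
    intro αf hαf hM t ht
    rw [hF]
    set z := Real.exp (-(Mos B α αf * t)) with hz
    have hz0 : 0 < z := Real.exp_pos _
    have hz1 : z ≤ 1 := Real.exp_le_one_iff.2 (by
      have := mul_nonneg hM ht.1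
      linarith)
    have hpos := Real.exp_pos (-((α + αf) * δ))
    rcases lt_or_ge z δ with h | h
    · have h1 := hsmall z hz0 h
      have h2 : Real.exp (-(2*α*z)) ≤ 1 := Real.exp_le_one_iff.2 (by
        have : 0 ≤ 2*α*z := by positivity
        linarith)
      have h3 : Real.exp (-((α+αf)*z)) ≤ 1 := Real.exp_le_one_iff.2 (by
        have : 0 ≤ (α+αf)*z := by positivity
        linarith)
      have h4 := mul_le_mul_of_nonneg_left h2 (by linarith : 0 ≤ 1 - B)
      have h5 := mul_le_mul_of_nonneg_left h3 hB0.le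
      have h6 : PhiOS B α z = (1 - B) * Real.exp (-(2*α*z)) + z * (1 - Real.log z) - 1 := rfl
      linarith
    · have h1 := hle z ⟨hz0.le, hz1⟩
      have h2 : Real.exp (-((α+αf)*z)) ≤ Real.exp (-((α+αf)*δ)) :=
        Real.exp_le_exp.2 (neg_le_neg (mul_le_mul_of_nonneg_left h (by linarith)))
      have h3 : B * Real.exp (-((α+αf)*z)) ≤ 1 * Real.exp (-((α+αf)*δ)) :=
        mul_le_mul hB1.le h2 (Real.exp_pos _).le zero_le_one
      linarith
  have hlim : Filter.Tendsto (fun αf : ℝ => S + Real.exp (-((α + αf) * δ))) Filter.atTop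
      (nhds S) := by
    simpa using hE.const_add S
  refine tendsto_of_tendsto_of_tendsto_of_le_of_le' tendsto_const_nhds hlim ?_ ?_
  · filter_upwards [Filter.eventually_ge_atTop 0, hMt.eventually_gt_atTop 0,
      hMt.eventually_ge_atTop (-Real.log y)] with αf h0 hM hMy
    have hlog : Real.log y ≤ 0 := Real.log_nonpos hy.1 hy.2
    have hmem : -Real.log y / Mos B α αf ∈ Icc (0:ℝ) 1 :=
      ⟨div_nonneg (by linarith) hM.le, (div_le_one hM).2 hMy⟩
    have hbdd : BddAbove (FOS B α αf '' Icc 0 1) := by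
      refine ⟨S + Real.exp (-((α + αf) * δ)), ?_⟩
      rintro _ ⟨t, ht, rfl⟩
      exact hupper αf h0 hM.le t ht
    refine le_trans ?_ (le_csSup hbdd ⟨_, hmem, rfl⟩)
    rw [hF, mul_div_cancel₀ _ hM.ne', neg_neg, Real.exp_log hy0]
    have := mul_pos hB0 (Real.exp_pos (-((α + αf) * y)))
    linarith
  · filter_upwards [Filter.eventually_ge_atTop 0, hMt.eventually_ge_atTop 0] with αf h0 hM
    apply csSup_le ((nonempty_Icc.2 zero_le_one).image _)
    rintro _ ⟨t, ht, rfl⟩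
    exact hupper αf h0 hM t ht
end

section
/- Let B ∈ (0,1) and α ≥ 0. Then, as α_f → ∞, the quantity max_{(t₁,t₂)∈[0,1]²} F_TS(t₁,t₂; B, α, α_f) converges to max(0, sup_{y∈(0,1]} Φ_TS(y)), where Φ_TS(y) = (1−B/2)(e^{−2α(1−B/2)y} + y(1 − ln y)) − 1. -/
open Set

/-- The limiting two-sided objective
`Φ_TS(y) = (1−B/2)(e^{−2α(1−B/2)y} + y(1 − ln y)) − 1`. -/
noncomputable def PhiTS (B α y : ℝ) : ℝ :=
  (1 - B/2) * (Real.exp (-(2*α*(1 - B/2)*y)) + y * (1 - Real.log y)) - 1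

/-- `F_TS` in the variables `y_i = exp (-M_i t_i)`. -/
noncomputable def GTS (B α αf y₁ y₂ : ℝ) : ℝ :=
  (1 - B/2) * Real.exp (-(2*α*(1 - B/2) * y₁) - (α + αf)*(B/2) * y₂)
  + (B/2) * Real.exp (-((α + αf)*(1 - B/2) * y₁) - αf*B * y₂)
  + (1 - B/2) * (y₁ * (1 - Real.log y₁))
  + (B/2) * (y₂ * (1 - Real.log y₂)) - 1

lemma FTS_eq_GTS (B α αf t₁ t₂ : ℝ) :
    FTS B α αf t₁ t₂ =
      GTS B α αf (Real.exp (-(M1 B α αf * t₁))) (Real.exp (-(M2 B α αf * t₂))) := by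
  unfold FTS GTS
  rw [Real.log_exp, Real.log_exp]
  ring

lemma g_nonneg {y : ℝ} (h0 : 0 < y) (h1 : y ≤ 1) : 0 ≤ y * (1 - Real.log y) := by
  have := Real.log_nonpos h0.le h1
  exact mul_nonneg h0.le (by linarith)

lemma g_le_one {y : ℝ} (h0 : 0 < y) : y * (1 - Real.log y) ≤ 1 := by
  have h := Real.one_sub_inv_le_log_of_pos h0
  have h2 : y * (1 - Real.log y) ≤ y * y⁻¹ :=
    mul_le_mul_of_nonneg_left (by linarith) h0.le
  rwa [mul_inv_cancel₀ h0.ne'] at h2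

lemma g_le_sqrt {y ε : ℝ} (h0 : 0 < y) (hε : 0 < ε) (hy : y ≤ ε ^ 2 / 4) :
    y * (1 - Real.log y) ≤ ε := by
  obtain ⟨s, hs, rfl⟩ : ∃ s : ℝ, 0 < s ∧ y = s ^ 2 :=
    ⟨Real.sqrt y, Real.sqrt_pos.2 h0, (Real.sq_sqrt h0.le).symm⟩
  have h := g_le_one hs
  have hs2 : s ≤ ε / 2 := by nlinarith
  rw [Real.log_pow]
  push_cast
  nlinarith [mul_le_mul_of_nonneg_left h hs.le]

lemma exp_le_of {x : ℝ} (h : x ≤ 0) : Real.exp x ≤ 1 := Real.exp_le_one_iff.2 h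

lemma GTS_le_one {B α αf y₁ y₂ : ℝ} (hB : B ∈ Ioo (0:ℝ) 1) (hα : 0 ≤ α) (hf : 0 ≤ αf)
    (h1 : 0 < y₁) (h2 : 0 < y₂) : GTS B α αf y₁ y₂ ≤ 1 := by
  obtain ⟨hB0, hB1⟩ := hB
  have ha : 0 < 1 - B/2 := by linarith
  have hb : 0 < B/2 := by linarith
  have e1 : Real.exp (-(2*α*(1 - B/2) * y₁) - (α + αf)*(B/2) * y₂) ≤ 1 := by
    apply exp_le_of
    have : 0 ≤ 2*α*(1 - B/2) * y₁ := by positivity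
    have : 0 ≤ (α + αf)*(B/2) * y₂ := by positivity
    linarith
  have e2 : Real.exp (-((α + αf)*(1 - B/2) * y₁) - αf*B * y₂) ≤ 1 := by
    apply exp_le_of
    have : 0 ≤ (α + αf)*(1 - B/2) * y₁ := by positivity
    have : 0 ≤ αf*B * y₂ := by positivity
    linarith
  have g1 := g_le_one h1
  have g2 := g_le_one h2
  unfold GTS
  nlinarith

lemma Phi_bdd {B α : ℝ} (hB : B ∈ Ioo (0:ℝ) 1) (hα : 0 ≤ α) :
    BddAbove (PhiTS B α '' Ioc 0 1) := by
  refine ⟨1, ?_⟩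
  rintro _ ⟨y, ⟨hy0, hy1⟩, rfl⟩
  obtain ⟨hB0, hB1⟩ := hB
  have ha : 0 < 1 - B/2 := by linarith
  have e1 : Real.exp (-(2*α*(1 - B/2) * y)) ≤ 1 := by
    apply exp_le_of
    have : 0 ≤ 2*α*(1 - B/2) * y := by positivity
    linarith
  have g1 := g_le_one hy0
  unfold PhiTS
  nlinarith

lemma GTS_upper {B α αf y₁ y₂ ε L : ℝ} (hB : B ∈ Ioo (0:ℝ) 1) (hα : 0 ≤ α) (hf : 0 ≤ αf)
    (h1 : 0 < y₁) (h1' : y₁ ≤ 1) (h2 : 0 < y₂) (hε : 0 < ε)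
    (hL0 : 0 ≤ L) (hL : ∀ y ∈ Ioc (0:ℝ) 1, PhiTS B α y ≤ L)
    (hbig : Real.exp (-(αf * (B/2) * (ε^2/4))) ≤ ε) : GTS B α αf y₁ y₂ ≤ L + 2 * ε := by
  obtain ⟨hB0, hB1⟩ := hB
  have ha : 0 < 1 - B/2 := by linarith
  have hb : 0 < B/2 := by linarith
  have g1 := g_le_one h1
  have g2 := g_le_one h2
  have p1 : 0 ≤ 2*α*(1 - B/2) * y₁ := by positivity
  have p2 : 0 ≤ (α + αf)*(B/2) * y₂ := by positivity
  have p3 : 0 ≤ (α + αf)*(1 - B/2) * y₁ := by positivity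
  have p4 : 0 ≤ αf*B * y₂ := by positivity
  have p5 : 0 ≤ α*(B/2) * y₂ := by positivity
  have p6 : 0 ≤ α*(1 - B/2) * y₁ := by positivity
  have q0 : 0 ≤ αf * (B/2) := by positivity
  unfold GTS
  rcases le_total (ε^2/4) y₂ with hy2 | hy2
  · have q := mul_le_mul_of_nonneg_left hy2 q0
    have e1 : Real.exp (-(2*α*(1 - B/2) * y₁) - (α + αf)*(B/2) * y₂) ≤ ε :=
      (Real.exp_le_exp.2 (by linarith)).trans hbig
    have e2 : Real.exp (-((α + αf)*(1 - B/2) * y₁) - αf*B * y₂) ≤ ε :=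
      (Real.exp_le_exp.2 (by linarith)).trans hbig
    nlinarith
  · have g2' := g_le_sqrt h2 hε hy2
    rcases le_total (ε^2/4) y₁ with hy1 | hy1
    · have q := mul_le_mul_of_nonneg_left hy1 q0
      have q' : αf * (B/2) * y₁ ≤ αf * (1 - B/2) * y₁ := by
        gcongr
        linarith
      have e1 : Real.exp (-(2*α*(1 - B/2) * y₁) - (α + αf)*(B/2) * y₂)
          ≤ Real.exp (-(2*α*(1 - B/2) * y₁)) := Real.exp_le_exp.2 (by linarith)
      have e2 : Real.exp (-((α + αf)*(1 - B/2) * y₁) - αf*B * y₂) ≤ ε :=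
        (Real.exp_le_exp.2 (by linarith)).trans hbig
      have hP := hL y₁ ⟨h1, h1'⟩
      unfold PhiTS at hP
      nlinarith
    · have g1' := g_le_sqrt h1 hε hy1
      have e1 : Real.exp (-(2*α*(1 - B/2) * y₁) - (α + αf)*(B/2) * y₂) ≤ 1 :=
        exp_le_of (by linarith)
      have e2 : Real.exp (-((α + αf)*(1 - B/2) * y₁) - αf*B * y₂) ≤ 1 :=
        exp_le_of (by linarith)
      nlinarith

lemma M1_nonneg {B α αf : ℝ} (hB : B ∈ Ioo (0:ℝ) 1) (hα : 0 ≤ α) (hf : 0 ≤ αf) :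
    0 ≤ M1 B α αf := by
  obtain ⟨hB0, hB1⟩ := hB
  unfold M1
  have : 0 ≤ 2 - B/2 := by linarith
  positivity

lemma TS_bdd {B α αf : ℝ} (hB : B ∈ Ioo (0:ℝ) 1) (hα : 0 ≤ α) (hf : 0 ≤ αf) :
    BddAbove ((fun p : ℝ × ℝ => FTS B α αf p.1 p.2) '' (Icc 0 1 ×ˢ Icc 0 1)) := by
  refine ⟨1, ?_⟩
  rintro _ ⟨p, -, rfl⟩
  simp only [FTS_eq_GTS]
  exact GTS_le_one hB hα hf (Real.exp_pos _) (Real.exp_pos _)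

lemma le_maxTS {B α αf t₁ t₂ : ℝ} (hB : B ∈ Ioo (0:ℝ) 1) (hα : 0 ≤ α) (hf : 0 ≤ αf)
    (h1 : t₁ ∈ Icc (0:ℝ) 1) (h2 : t₂ ∈ Icc (0:ℝ) 1) : FTS B α αf t₁ t₂ ≤ maxTS B α αf :=
  le_csSup (TS_bdd hB hα hf) ⟨(t₁, t₂), ⟨h1, h2⟩, rfl⟩

lemma maxTS_nonneg {B α αf : ℝ} (hB : B ∈ Ioo (0:ℝ) 1) (hα : 0 ≤ α) (hf : 0 ≤ αf) :
    0 ≤ maxTS B α αf := by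
  refine le_trans ?_ (le_maxTS hB hα hf (t₁ := 0) (t₂ := 0) (by simp) (by simp))
  obtain ⟨hB0, hB1⟩ := hB
  have ha : 0 < 1 - B/2 := by linarith
  have hb : 0 < B/2 := by linarith
  rw [FTS_eq_GTS]
  unfold GTS
  simp only [mul_zero, neg_zero, Real.exp_zero, Real.log_one, mul_one, sub_zero]
  have := mul_pos ha (Real.exp_pos (-(2 * α * (1 - B / 2)) - (α + αf) * (B / 2)))
  have := mul_pos hb (Real.exp_pos (-((α + αf) * (1 - B / 2)) - αf * B))
  linarith

lemma maxTS_lower {B α αf y : ℝ} (hB : B ∈ Ioo (0:ℝ) 1) (hα : 0 ≤ α) (hf : 0 < αf)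
    (hy : y ∈ Ioc (0:ℝ) 1) (hM : -Real.log y ≤ B/2 * αf) :
    PhiTS B α y - 8 / αf ≤ maxTS B α αf := by
  have hB' := hB
  obtain ⟨hB0, hB1⟩ := hB'
  obtain ⟨hy0, hy1⟩ := hy
  have ha : 0 < 1 - B/2 := by linarith
  have hb : 0 < B/2 := by linarith
  have hM1 : B/2 * αf ≤ M1 B α αf := by
    unfold M1
    have : 0 ≤ (2 - B/2) * α := mul_nonneg (by linarith) hα
    linarith
  have hM1p : 0 < M1 B α αf := lt_of_lt_of_le (by positivity) hM1
  have hl := Real.log_nonpos hy0.le hy1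
  have ht : -Real.log y / M1 B α αf ∈ Icc (0:ℝ) 1 :=
    ⟨div_nonneg (by linarith) hM1p.le, (div_le_one hM1p).2 (by linarith)⟩
  refine le_trans ?_ (le_maxTS hB hα hf.le ht (t₂ := 1) (by simp))
  rw [FTS_eq_GTS, mul_div_cancel₀ _ hM1p.ne', neg_neg, Real.exp_log hy0, mul_one]
  have hx : 0 < α + αf := by linarith
  have hM2 : (α + αf) / 2 ≤ M2 B α αf := by
    unfold M2
    nlinarith
  have hM2p : 0 ≤ M2 B α αf := by linarith
  have hz0 : 0 < Real.exp (-M2 B α αf) := Real.exp_pos _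
  have hz1 : Real.exp (-M2 B α αf) ≤ 1 := exp_le_of (by linarith)
  have hzle : (α + αf) * Real.exp (-M2 B α αf) ≤ 8 / αf := by
    have h1 : Real.exp (-M2 B α αf) ≤ Real.exp (-((α + αf)/2)) := Real.exp_le_exp.2 (by linarith)
    have h2 := Real.quadratic_le_exp_of_nonneg (x := (α + αf)/2) (by linarith)
    have h3 : Real.exp (-((α + αf)/2)) * Real.exp ((α + αf)/2) = 1 := by
      rw [← Real.exp_add]; simp
    have h4 : (α + αf)^2 / 8 * Real.exp (-((α + αf)/2)) ≤ 1 := by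
      have := mul_le_mul_of_nonneg_left h2 (Real.exp_pos (-((α + αf)/2))).le
      nlinarith [Real.exp_pos (-((α + αf)/2))]
    rw [le_div_iff₀ hf]
    have h5 : (α + αf) * Real.exp (-M2 B α αf) * αf
        ≤ (α + αf) * Real.exp (-((α + αf)/2)) * (α + αf) := by
      gcongr
      linarith
    nlinarith
  generalize Real.exp (-M2 B α αf) = z at *
  have g2 := g_nonneg hz0 hz1
  unfold GTS PhiTS
  rw [sub_eq_add_neg (-(2*α*(1 - B/2) * y)), Real.exp_add]
  have h6 := Real.add_one_le_exp (-((α + αf) * (B/2) * z))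
  have h7 : Real.exp (-(2*α*(1 - B/2) * y)) ≤ 1 := by
    apply exp_le_of
    have : 0 ≤ 2*α*(1 - B/2) * y := by positivity
    linarith
  have h8 := Real.exp_pos (-(2*α*(1 - B/2) * y))
  have h9 := mul_pos hb (Real.exp_pos (-((α + αf)*(1 - B/2) * y) - αf*B * z))
  have h10 := mul_nonneg hb.le g2
  generalize Real.exp (-(2*α*(1 - B/2) * y)) = E at *
  have hu0 : 0 ≤ (α + αf) * (B/2) * z := by positivity
  have hu : (α + αf) * (B/2) * z ≤ 8 / αf := by
    have : (α + αf) * z * (B/2) ≤ (α + αf) * z * 1 := by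
      gcongr
      linarith
    linarith
  generalize Real.exp (-((α + αf) * (B/2) * z)) = W at *
  generalize (α + αf) * (B/2) * z = u at *
  have k1 : E - u ≤ E * W := by nlinarith
  have k2 := mul_le_mul_of_nonneg_left k1 ha.le
  have k3 : (1 - B/2) * u ≤ u := by nlinarith
  linarith

/-- As `α_f → ∞`, `max_{(t₁,t₂)∈[0,1]²} F_TS` converges to
`max(0, sup_{y∈(0,1]} Φ_TS(y))`. -/
theorem limit_two_sided (B α : ℝ) (hB : B ∈ Ioo (0:ℝ) 1) (hα : 0 ≤ α) :
    Filter.Tendsto (fun αf => maxTS B α αf) Filter.atTop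
      (nhds (max 0 (sSup (PhiTS B α '' Ioc 0 1)))) := by
  have hne : (PhiTS B α '' Ioc 0 1).Nonempty := ⟨_, 1, by simp, rfl⟩
  have hb : 0 < B/2 := by linarith [hB.1]
  refine tendsto_order.2 ⟨fun c hc => ?_, fun c hc => ?_⟩
  · rcases lt_max_iff.1 hc with hc | hc
    · filter_upwards [Filter.eventually_ge_atTop 0] with αf hf
      exact hc.trans_le (maxTS_nonneg hB hα hf)
    · obtain ⟨_, ⟨y, hy, rfl⟩, hcy⟩ := exists_lt_of_lt_csSup hne hc
      filter_upwards [Filter.eventually_gt_atTop 0,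
        Filter.eventually_ge_atTop (-Real.log y / (B/2)),
        Filter.eventually_gt_atTop (8 / (PhiTS B α y - c))] with αf hf h1 h2
      have hd : 0 < PhiTS B α y - c := by linarith
      have h3 := maxTS_lower hB hα hf hy (by rw [div_le_iff₀ hb] at h1; linarith)
      have h4 : 8 / αf < PhiTS B α y - c := by
        rw [div_lt_iff₀ hd] at h2
        rw [div_lt_iff₀ hf]
        linarith
      linarith
  · set L := max 0 (sSup (PhiTS B α '' Ioc 0 1)) with hLdef
    obtain ⟨ε, hε, hcε⟩ : ∃ ε : ℝ, 0 < ε ∧ L + 2 * ε < c :=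
      ⟨(c - L) / 4, by linarith, by linarith⟩
    have hk : 0 < B/2 * (ε^2/4) := by positivity
    filter_upwards [Filter.eventually_ge_atTop 0,
      Filter.eventually_ge_atTop (-Real.log ε / (B/2 * (ε^2/4)))] with αf hf h1
    refine lt_of_le_of_lt ?_ hcε
    have hbig : Real.exp (-(αf * (B/2) * (ε^2/4))) ≤ ε := by
      rw [← Real.le_log_iff_exp_le hε]
      rw [div_le_iff₀ hk] at h1
      linarith
    refine csSup_le ⟨_, (0, 0), by simp, rfl⟩ ?_
    rintro _ ⟨⟨t₁, t₂⟩, ⟨ht1, ht2⟩, rfl⟩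
    simp only [FTS_eq_GTS]
    refine GTS_upper hB hα hf (Real.exp_pos _) (exp_le_of ?_) (Real.exp_pos _) hε
      (le_max_left _ _) (fun y hy => ?_) hbig
    · have := mul_nonneg (M1_nonneg hB hα hf) ht1.1
      linarith
    · exact (le_csSup (Phi_bdd hB hα) ⟨y, hy, rfl⟩).trans (le_max_right _ _)
end

section
/- Fix B ∈ (0,1) and define g : (0,1] → ℝ by g(y) = B·e^{−α_f·y} + y(1 − ln y) − B, depending on a parameter α_f > 0. Let c_B ∈ (0,1) be the unique solution of x(1 − ln x) = 1 − B on (0,1). Then there exists a threshold A(B) > 0 such that for all α_f > A(B): e^{−α_f·B} ≤ c_B, and every global maximizer y* of g over the interval [e^{−α_f·B}, 1] satisfies c_B < y* < 1. -/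
open Set

/-- `g(y) = B·e^{−α_f y} + y(1 − ln y) − B`, the one-sided objective (at `α = 0`)
after the change of variable `y = e^{−α_f B t₁}`. -/
noncomputable def g (B αf y : ℝ) : ℝ :=
  B * Real.exp (-(αf * y)) + y * (1 - Real.log y) - B

/-- For sufficiently large `α_f`, `e^{−α_f B} ≤ c_B` and every global maximizer `y*`
of `g` over `[e^{−α_f B}, 1]` satisfies `c_B < y* < 1`, where `c_B ∈ (0,1)` is the
unique solution of `x(1 − ln x) = 1 − B`. -/
theorem maximizer_location (B : ℝ) (hB : B ∈ Ioo (0:ℝ) 1)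
    (c : ℝ) (hc : c ∈ Ioo (0:ℝ) 1) (hceq : c * (1 - Real.log c) = 1 - B) :
    ∃ A : ℝ, 0 < A ∧ ∀ αf : ℝ, A < αf →
      Real.exp (-(αf * B)) ≤ c ∧
      ∀ ystar ∈ Icc (Real.exp (-(αf * B))) 1,
        (∀ y ∈ Icc (Real.exp (-(αf * B))) 1, g B αf y ≤ g B αf ystar) →
        c < ystar ∧ ystar < 1 := by
  obtain ⟨hB0, hB1⟩ := hB
  obtain ⟨hc0, hc1⟩ := hc
  have hlc : Real.log c < 0 := Real.log_neg hc0 hc1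
  have hq : 0 < -Real.log c / B := div_pos (by linarith) hB0
  refine ⟨-Real.log c / B, hq, fun a ha => ?_⟩
  have ha0 : 0 < a := hq.trans ha
  have hab : -Real.log c < a * B := (div_lt_iff₀ hB0).1 ha
  have haB : 0 < a * B := mul_pos ha0 hB0
  have hexp1 : Real.exp (-(a * B)) < 1 := by
    rw [Real.exp_lt_one_iff]
    linarith
  refine ⟨?_, ?_⟩
  · rw [← Real.le_log_iff_exp_le hc0]
    linarith
  intro s hs hmax
  have hs0 : 0 < s := (Real.exp_pos _).trans_le hs.1
  constructor
  · by_contra hcs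
    have hcs : s ≤ c := not_lt.1 hcs
    have h1 := hmax 1 ⟨hexp1.le, le_rfl⟩
    simp only [g, Real.log_one] at h1
    have h2 : B * Real.exp (-(a * s)) < B := by
      have : Real.exp (-(a * s)) < 1 := by
        rw [Real.exp_lt_one_iff]
        linarith [mul_pos ha0 hs0]
      nlinarith
    have h3 : 0 < B * Real.exp (-(a * 1)) := mul_pos hB0 (Real.exp_pos _)
    have h4 := Real.log_le_sub_one_of_pos (div_pos hc0 hs0)
    rw [Real.log_div hc0.ne' hs0.ne'] at h4
    have h5 : s * (Real.log c - Real.log s) ≤ c - s := by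
      have := mul_le_mul_of_nonneg_left h4 hs0.le
      have e : s * (c / s - 1) = c - s := by field_simp
      linarith
    nlinarith [mul_nonneg (sub_nonneg.2 hcs) (neg_pos.2 hlc).le]
  · by_contra h
    have hs1 : s = 1 := le_antisymm hs.2 (not_lt.1 h)
    subst hs1
    have hD : 0 < B * a * Real.exp (-a) := by positivity
    obtain ⟨t, ht0, ht⟩ : ∃ t, 0 < t ∧ t < min (1 - Real.exp (-(a * B))) (B * a * Real.exp (-a)) :=
      exists_between (lt_min (by linarith) hD)
    obtain ⟨ht1, ht2⟩ := lt_min_iff.1 ht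
    have hy0 : 0 < 1 - t := by linarith [Real.exp_pos (-(a * B))]
    have h1 := hmax (1 - t) ⟨by linarith, by linarith⟩
    simp only [g, Real.log_one, mul_one] at h1
    have h2 := Real.log_le_sub_one_of_pos hy0
    have h3 : (1 - t) * (1 + t) ≤ (1 - t) * (1 - Real.log (1 - t)) :=
      mul_le_mul_of_nonneg_left (by linarith) hy0.le
    have h4 : Real.exp (-(a * (1 - t))) = Real.exp (-a) * Real.exp (a * t) := by
      rw [← Real.exp_add]
      ring_nf
    have h5 : B * (Real.exp (-a) * (a * t + 1)) ≤ B * (Real.exp (-a) * Real.exp (a * t)) := by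
      gcongr
      exact Real.add_one_le_exp _
    rw [h4] at h1
    have h6 := mul_lt_mul_of_pos_left ht2 ht0
    linarith
end

section
/- Fix B ∈ (0,1). For α ≥ 0 define Ψ(α) = sup_{y∈(0,1]} Φ_TS(y; α) (this supremum is attained). Then Ψ is strictly decreasing in α, Ψ(0) = 1 − B > 0, Ψ(α) → −B/2 < 0 as α → ∞, and there exists a unique α(B) ∈ (0,∞) with Ψ(α(B)) = 0; consequently max(0, Ψ(α)) = 0 for all α ≥ α(B). Moreover, if B ≥ 2 − 2e/3, then α(B) ≤ e/(2−B). -/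
open Set

/-- `Ψ(α) = sup_{y∈(0,1]} Φ_TS(y; α)`. -/
noncomputable def Psi (B α : ℝ) : ℝ := sSup (PhiTS B α '' Ioc 0 1)

lemma aux_cont (B α : ℝ) : Continuous (PhiTS B α) := by
  have h : Continuous fun y : ℝ => y * (1 - Real.log y) := by
    have h2 : (fun y : ℝ => y * (1 - Real.log y)) = fun y => y - y * Real.log y := by
      funext y; ring
    rw [h2]
    exact continuous_id.sub Real.continuous_mul_log
  unfold PhiTS
  fun_prop

lemma aux_g_le (y : ℝ) (hy : 0 < y) : y * (1 - Real.log y) ≤ 1 := by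
  have h := Real.one_sub_inv_le_log_of_pos hy
  have h2 : y * (1 - Real.log y) ≤ y * y⁻¹ := by
    apply mul_le_mul_of_nonneg_left _ hy.le
    linarith
  rwa [mul_inv_cancel₀ hy.ne'] at h2

lemma aux_max (B α : ℝ) (hB : B ∈ Ioo (0:ℝ) 1) :
    ∃ y ∈ Ioc (0:ℝ) 1, ∀ z ∈ Ioc (0:ℝ) 1, PhiTS B α z ≤ PhiTS B α y := by
  obtain ⟨y, hy, hmax⟩ := isCompact_Icc.exists_isMaxOn (nonempty_Icc.2 (zero_le_one (α := ℝ)))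
    (aux_cont B α).continuousOn
  refine ⟨y, ⟨lt_of_le_of_ne hy.1 ?_, hy.2⟩, fun z hz => hmax ⟨hz.1.le, hz.2⟩⟩
  intro h0
  have h1 : PhiTS B α 1 ≤ PhiTS B α y := hmax ⟨zero_le_one, le_refl _⟩
  rw [← h0] at h1
  simp only [PhiTS, mul_zero, neg_zero, Real.exp_zero, zero_mul, Real.log_one, mul_one] at h1
  have hc : 0 < 1 - B/2 := by linarith [hB.2]
  have := mul_pos hc (Real.exp_pos (-(2*α*(1 - B/2))))
  nlinarith

lemma aux_isLUB (B α : ℝ) (hB : B ∈ Ioo (0:ℝ) 1) :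
    ∃ y ∈ Ioc (0:ℝ) 1, PhiTS B α y = Psi B α := by
  obtain ⟨y, hy, hm⟩ := aux_max B α hB
  refine ⟨y, hy, ?_⟩
  have : IsGreatest (PhiTS B α '' Ioc 0 1) (PhiTS B α y) := by
    refine ⟨⟨y, hy, rfl⟩, ?_⟩
    rintro _ ⟨z, hz, rfl⟩
    exact hm z hz
  exact this.csSup_eq.symm

lemma aux_le (B α : ℝ) (hB : B ∈ Ioo (0:ℝ) 1) (z : ℝ) (hz : z ∈ Ioc (0:ℝ) 1) :
    PhiTS B α z ≤ Psi B α := by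
  obtain ⟨y, hy, hm⟩ := aux_max B α hB
  refine le_csSup ?_ (mem_image_of_mem _ hz)
  refine ⟨PhiTS B α y, ?_⟩
  rintro _ ⟨z, hz, rfl⟩
  exact hm z hz

lemma aux_anti (B : ℝ) (hB : B ∈ Ioo (0:ℝ) 1) : StrictAnti (Psi B) := by
  intro a b hab
  obtain ⟨y, hy, h⟩ := aux_isLUB B b hB
  rw [← h]
  refine lt_of_lt_of_le ?_ (aux_le B a hB y hy)
  have hc : 0 < 1 - B/2 := by linarith [hB.2]
  have : Real.exp (-(2*b*(1 - B/2)*y)) < Real.exp (-(2*a*(1 - B/2)*y)) := by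
    apply Real.exp_lt_exp.2
    have := mul_pos (sub_pos.2 hab) (mul_pos hc hy.1)
    nlinarith
  unfold PhiTS
  have := mul_lt_mul_of_pos_left this hc
  linarith

lemma aux_lip (B : ℝ) (hB : B ∈ Ioo (0:ℝ) 1) (a b : ℝ) (ha : 0 ≤ a) (hab : a ≤ b) :
    Psi B a ≤ Psi B b + 2 * (b - a) := by
  obtain ⟨y, hy, h⟩ := aux_isLUB B a hB
  rw [← h]
  have h1 := aux_le B b hB y hy
  have hc : 0 < 1 - B/2 := by linarith [hB.2]
  have hc1 : 1 - B/2 < 1 := by linarith [hB.1]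
  have hcy : (1 - B/2) * y ≤ 1 := by nlinarith [hy.1, hy.2]
  have hcy0 : 0 < (1 - B/2) * y := mul_pos hc hy.1
  set u := 2*a*(1 - B/2)*y with hu
  set v := 2*b*(1 - B/2)*y with hv
  have hu0 : 0 ≤ u := by rw [hu]; have := hy.1; positivity
  have huv : v - u ≤ 2 * (b - a) := by
    have : v - u = 2 * (b - a) * ((1 - B/2) * y) := by rw [hu, hv]; ring
    rw [this]
    nlinarith
  have huv0 : 0 ≤ v - u := by
    have : v - u = 2 * (b - a) * ((1 - B/2) * y) := by rw [hu, hv]; ring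
    rw [this]
    have : 0 ≤ b - a := by linarith
    positivity
  have he : Real.exp (-u) - Real.exp (-v) ≤ v - u := by
    have e1 : Real.exp (-v) = Real.exp (-u) * Real.exp (-(v-u)) := by
      rw [← Real.exp_add]; ring_nf
    have e2 := Real.add_one_le_exp (-(v-u))
    have e3 : Real.exp (-u) ≤ 1 := Real.exp_le_one_iff.2 (by linarith)
    have e4 := Real.exp_pos (-u)
    rw [e1]
    nlinarith
  unfold PhiTS at h1 ⊢
  rw [← hu]
  rw [← hv] at h1
  nlinarith

lemma aux_contPsi (B : ℝ) (hB : B ∈ Ioo (0:ℝ) 1) : ContinuousOn (Psi B) (Ici 0) := by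
  have : LipschitzOnWith 2 (Psi B) (Ici 0) := by
    apply LipschitzOnWith.of_le_add_mul
    intro x hx y hy
    rw [Real.dist_eq]
    push_cast
    rcases le_total x y with h | h
    · have := aux_lip B hB x y hx h
      rw [abs_sub_comm, abs_of_nonneg (sub_nonneg.2 h)]
      exact this
    · have := (aux_anti B hB).antitone h
      have := abs_nonneg (x - y)
      linarith
  exact this.continuousOn

lemma aux_zero (B : ℝ) (hB : B ∈ Ioo (0:ℝ) 1) : Psi B 0 = 1 - B := by
  apply le_antisymm
  · obtain ⟨y, hy, h⟩ := aux_isLUB B 0 hB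
    rw [← h]
    have := aux_g_le y hy.1
    have hc : 0 < 1 - B/2 := by linarith [hB.2]
    simp only [PhiTS, mul_zero, zero_mul, neg_zero, Real.exp_zero]
    nlinarith
  · have := aux_le B 0 hB 1 ⟨one_pos, le_refl _⟩
    simp only [PhiTS, mul_zero, zero_mul, neg_zero, Real.exp_zero, Real.log_one] at this
    linarith

lemma aux_lower (B α : ℝ) (hB : B ∈ Ioo (0:ℝ) 1) : -B/2 < Psi B α := by
  have h := aux_le B α hB 1 ⟨one_pos, le_refl _⟩
  have hc : 0 < 1 - B/2 := by linarith [hB.2]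
  have h2 := mul_pos hc (Real.exp_pos (-(2*α*(1 - B/2)*1)))
  simp only [PhiTS, Real.log_one] at h
  linarith

lemma aux_lim (B : ℝ) (hB : B ∈ Ioo (0:ℝ) 1) :
    Filter.Tendsto (Psi B) Filter.atTop (nhds (-B/2)) := by
  have hc : 0 < 1 - B/2 := by linarith [hB.2]
  have hc1 : 1 - B/2 < 1 := by linarith [hB.1]
  rw [Metric.tendsto_nhds]
  intro ε hε
  have hg : Continuous fun y : ℝ => y * (1 - Real.log y) := by
    have h2 : (fun y : ℝ => y * (1 - Real.log y)) = fun y => y - y * Real.log y := by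
      funext y; ring
    rw [h2]
    exact continuous_id.sub Real.continuous_mul_log
  obtain ⟨δ, hδ, hd⟩ := Metric.continuous_iff.1 hg 0 ε hε
  have hexp : Filter.Tendsto (fun α : ℝ => Real.exp (-(2*α*(1 - B/2)*δ))) Filter.atTop (nhds 0) := by
    apply Real.tendsto_exp_neg_atTop_nhds_zero.comp
    have : (fun α : ℝ => 2*α*(1 - B/2)*δ) = fun α => α * (2 * (1 - B/2) * δ) := by
      funext α; ring
    rw [this]
    exact Filter.tendsto_id.atTop_mul_const (by positivity)
  filter_upwards [hexp.eventually (gt_mem_nhds hε), Filter.eventually_ge_atTop (0:ℝ)] with α h1 h0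
  have hl := aux_lower B α hB
  rw [Real.dist_eq, abs_of_pos (by linarith)]
  obtain ⟨y, hy, h⟩ := aux_isLUB B α hB
  rw [← h]
  have hy0 := hy.1
  have key : Real.exp (-(2*α*(1 - B/2)*y)) + y * (1 - Real.log y) ≤ 1 + ε := by
    rcases lt_or_ge y δ with hyd | hyd
    · have := hd y (by rw [Real.dist_eq, sub_zero, abs_of_pos hy.1]; exact hyd)
      rw [Real.dist_eq] at this
      have h3 := (abs_lt.1 this).2
      have h4 : Real.exp (-(2*α*(1 - B/2)*y)) ≤ 1 := by
        apply Real.exp_le_one_iff.2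
        have : 0 ≤ 2*α*(1 - B/2)*y := by positivity
        linarith
      simp only [zero_mul, sub_zero] at h3
      linarith
    · have h3 := aux_g_le y hy.1
      have h4 : Real.exp (-(2*α*(1 - B/2)*y)) ≤ Real.exp (-(2*α*(1 - B/2)*δ)) := by
        apply Real.exp_le_exp.2
        have : 2*α*(1 - B/2)*δ ≤ 2*α*(1 - B/2)*y := by gcongr
        linarith
      linarith
  unfold PhiTS
  nlinarith

lemma aux_phi_s8 : MonotoneOn (fun t : ℝ => Real.log t + Real.exp (1 - t)) (Ioi 0) := by
  have hd : ∀ t ∈ Ioi (0:ℝ), HasDerivAt (fun t : ℝ => Real.log t + Real.exp (1 - t))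
      (t⁻¹ + Real.exp (1 - t) * (-1)) t := by
    intro t ht
    exact (Real.hasDerivAt_log (ne_of_gt ht)).add ((hasDerivAt_id t).const_sub 1).exp
  apply monotoneOn_of_deriv_nonneg (convex_Ioi 0)
  · exact fun t ht => (hd t ht).continuousAt.continuousWithinAt
  · rw [interior_Ioi]
    exact fun t ht => (hd t ht).differentiableAt.differentiableWithinAt
  · rw [interior_Ioi]
    intro t ht
    rw [(hd t ht).deriv]
    have h1 : t ≤ Real.exp (t - 1) := by linarith [Real.add_one_le_exp (t - 1)]
    have h2 : Real.exp (1 - t) = (Real.exp (t - 1))⁻¹ := by rw [← Real.exp_neg]; ring_nf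
    have h3 : (Real.exp (t - 1))⁻¹ ≤ t⁻¹ := inv_anti₀ ht h1
    rw [h2]; linarith

lemma aux_h (t : ℝ) (ht : 0 < t) : Real.exp (1 - t) + 2 * t - t * Real.log t ≤ 3 := by
  set h : ℝ → ℝ := fun t => Real.exp (1 - t) + 2 * t - t * Real.log t with hh
  have hd : ∀ t ∈ Ioi (0:ℝ), HasDerivAt h (1 - (Real.log t + Real.exp (1 - t))) t := by
    intro t ht
    have := ((((hasDerivAt_id t).const_sub 1).exp).add ((hasDerivAt_id t).const_mul 2)).sub
      ((hasDerivAt_id t).mul (Real.hasDerivAt_log (ne_of_gt ht)))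
    refine this.congr_deriv ?_
    have ht' : t ≠ 0 := ne_of_gt ht
    simp only [id]
    field_simp
    ring
  have h1 : h 1 = 3 := by simp [hh]; norm_num
  change h t ≤ 3
  rw [← h1]
  have p1 : Real.log 1 + Real.exp (1 - 1) = 1 := by simp
  rcases le_total t 1 with hle | hle
  · have hm : MonotoneOn h (Icc t 1) := by
      have hs : ∀ x ∈ Icc t 1, x ∈ Ioi (0:ℝ) := fun x hx => lt_of_lt_of_le ht hx.1
      apply monotoneOn_of_deriv_nonneg (convex_Icc t 1)
      · exact fun x hx => (hd x (hs x hx)).continuousAt.continuousWithinAt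
      · exact fun x hx => (hd x (hs x (interior_subset hx))).differentiableAt.differentiableWithinAt
      · intro x hx
        have hx' := interior_subset hx
        rw [(hd x (hs x hx')).deriv]
        have := aux_phi_s8 (hs x hx') (mem_Ioi.2 one_pos) hx'.2
        simp only at this
        linarith
    exact hm ⟨le_refl _, hle⟩ ⟨hle, le_refl _⟩ hle
  · have hm : AntitoneOn h (Icc 1 t) := by
      have hs : ∀ x ∈ Icc 1 t, x ∈ Ioi (0:ℝ) := fun x hx => lt_of_lt_of_le one_pos hx.1
      apply antitoneOn_of_deriv_nonpos (convex_Icc 1 t)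
      · exact fun x hx => (hd x (hs x hx)).continuousAt.continuousWithinAt
      · exact fun x hx => (hd x (hs x (interior_subset hx))).differentiableAt.differentiableWithinAt
      · intro x hx
        have hx' := interior_subset hx
        rw [(hd x (hs x hx')).deriv]
        have := aux_phi_s8 (mem_Ioi.2 one_pos) (hs x hx') hx'.1
        simp only at this
        linarith
    exact hm ⟨le_refl _, hle⟩ ⟨hle, le_refl _⟩ hle

lemma aux_bound (B : ℝ) (hB : B ∈ Ioo (0:ℝ) 1) (h : 2 - 2 * Real.exp 1 / 3 ≤ B) :
    Psi B (Real.exp 1 / (2 - B)) ≤ 0 := by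
  obtain ⟨y, hy, hP⟩ := aux_isLUB B (Real.exp 1 / (2 - B)) hB
  rw [← hP]
  have hc : 0 < 1 - B/2 := by linarith [hB.2]
  have hE := Real.exp_pos 1
  have h1 : 2 * (Real.exp 1 / (2 - B)) * (1 - B/2) * y = Real.exp 1 * y := by
    have : 2 - B ≠ 0 := by linarith [hB.2]
    field_simp
  unfold PhiTS
  rw [h1]
  have hk := aux_h (Real.exp 1 * y) (mul_pos hE hy.1)
  rw [Real.log_mul hE.ne' hy.1.ne', Real.log_exp, sub_eq_add_neg 1 (Real.exp 1 * y), Real.exp_add] at hk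
  set X := Real.exp (-(Real.exp 1 * y)) + y * (1 - Real.log y) with hX
  have hk2 : Real.exp 1 * X ≤ 3 := by rw [hX]; linarith
  have hX0 : 0 ≤ X := by
    have := Real.log_nonpos hy.1.le hy.2
    have h3 : 0 ≤ 1 - Real.log y := by linarith
    have := hy.1
    positivity
  have : (1 - B/2) * X ≤ Real.exp 1 / 3 * X := mul_le_mul_of_nonneg_right (by linarith) hX0
  linarith

/-- `Ψ` is attained, strictly decreasing on `[0,∞)`, with `Ψ(0) = 1 − B > 0` and
`Ψ(α) → −B/2 < 0`; there is a unique `α(B) > 0` with `Ψ(α(B)) = 0`, and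
`max(0, Ψ(α)) = 0` for `α ≥ α(B)`; moreover `α(B) ≤ e/(2−B)` when `B ≥ 2 − 2e/3`. -/
theorem Psi_root_properties (B : ℝ) (hB : B ∈ Ioo (0:ℝ) 1) :
    (∀ α : ℝ, 0 ≤ α → ∃ y ∈ Ioc (0:ℝ) 1, PhiTS B α y = Psi B α) ∧
    StrictAntiOn (Psi B) (Ici 0) ∧
    Psi B 0 = 1 - B ∧ (0:ℝ) < 1 - B ∧
    Filter.Tendsto (Psi B) Filter.atTop (nhds (-B/2)) ∧ (-B/2 : ℝ) < 0 ∧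
    (∃! a : ℝ, 0 < a ∧ Psi B a = 0) ∧
    (∀ a : ℝ, 0 < a → Psi B a = 0 →
      (∀ α : ℝ, a ≤ α → max 0 (Psi B α) = 0) ∧
      (2 - 2 * Real.exp 1 / 3 ≤ B → a ≤ Real.exp 1 / (2 - B))) := by
  have hanti := aux_anti B hB
  have hB0 := hB.1
  have hB1 := hB.2
  refine ⟨fun α _ => aux_isLUB B α hB, hanti.strictAntiOn _, aux_zero B hB, by linarith,
    aux_lim B hB, by linarith, ?_, ?_⟩
  · obtain ⟨M, hM, hM0⟩ := (((aux_lim B hB).eventually (gt_mem_nhds (by linarith : -B/2 < 0))).and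
      (Filter.eventually_ge_atTop (0:ℝ))).exists
    obtain ⟨a, ha, ha0⟩ := intermediate_value_Icc' hM0
      ((aux_contPsi B hB).mono Icc_subset_Ici_self)
      (show (0:ℝ) ∈ Icc (Psi B M) (Psi B 0) from ⟨hM.le, by rw [aux_zero B hB]; linarith⟩)
    refine ⟨a, ⟨lt_of_le_of_ne ha.1 ?_, ha0⟩, fun b hb => hanti.injective (hb.2.trans ha0.symm)⟩
    intro h
    rw [← h, aux_zero B hB] at ha0
    linarith
  · intro a _ ha0
    refine ⟨fun α hα => max_eq_left ?_, fun h => ?_⟩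
    · rw [← ha0]
      exact hanti.antitone hα
    · rw [← hanti.le_iff_ge, ha0]
      exact aux_bound B hB h
end

section
/- Fix B ∈ (0,1) and α > 0 with 2α(1−B/2) < e. Then Φ_TS admits a unique maximizer y* over (0,1], this maximizer lies in the open interval (0,1), and it satisfies both ln y* = −2α(1−B/2)·e^{−2α(1−B/2)·y*} and y* = e^{−2α(1−B/2)·y*}. -/
open Set

/-- The negative of the derivative is strictly increasing. -/
lemma aux_mono (c : ℝ) (hc : 0 < c) (hce : c < Real.exp 1) :
    StrictMonoOn (fun y : ℝ => Real.log y + c * Real.exp (-(c*y))) (Ioi 0) := by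
  have hd : ∀ y : ℝ, 0 < y → HasDerivAt (fun y : ℝ => Real.log y + c * Real.exp (-(c*y)))
      (y⁻¹ + c * (Real.exp (-(c*y)) * (-(c*1)))) y := by
    intro y hy
    exact (Real.hasDerivAt_log hy.ne').add
      ((((hasDerivAt_id y).const_mul c).neg.exp).const_mul c)
  apply strictMonoOn_of_deriv_pos (convex_Ioi 0)
  · intro y hy
    exact (hd y hy).continuousAt.continuousWithinAt
  · intro y hy
    rw [interior_Ioi] at hy
    have hy : 0 < y := hy
    rw [(hd y hy).deriv]
    have h1 : c * y ≤ Real.exp (c*y - 1) := by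
      have := Real.add_one_le_exp (c*y - 1); linarith
    have h2 : c * y * Real.exp (-(c*y)) ≤ Real.exp (-1) := by
      calc c * y * Real.exp (-(c*y)) ≤ Real.exp (c*y-1) * Real.exp (-(c*y)) := by gcongr
        _ = Real.exp (-1) := by rw [← Real.exp_add]; congr 1; ring
    have h3 : c * (c * y * Real.exp (-(c*y))) < 1 := by
      calc c * (c * y * Real.exp (-(c*y))) ≤ c * Real.exp (-1) := by gcongr
        _ < Real.exp 1 * Real.exp (-1) := by gcongr
        _ = 1 := by rw [← Real.exp_add]; simp
    have h4 : y⁻¹ + c * (Real.exp (-(c*y)) * (-(c*1)))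
        = y⁻¹ * (1 - c * (c * y * Real.exp (-(c*y)))) := by
      field_simp
      ring
    rw [h4]
    exact mul_pos (inv_pos.mpr hy) (by linarith)

lemma aux_max_s9 (c : ℝ) (hc : 0 < c) (hce : c < Real.exp 1) (y0 : ℝ) (h0 : 0 < y0)
    (hcr : Real.log y0 + c * Real.exp (-(c*y0)) = 0) (y : ℝ) (hy : 0 < y) (hne : y ≠ y0) :
    Real.exp (-(c*y)) + y * (1 - Real.log y) < Real.exp (-(c*y0)) + y0 * (1 - Real.log y0) := by
  have hm := aux_mono c hc hce
  have hd : ∀ y : ℝ, 0 < y → HasDerivAt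
      (fun y : ℝ => Real.exp (-(c*y)) + y * (1 - Real.log y))
      (-(Real.log y + c * Real.exp (-(c*y)))) y := by
    intro y hy
    have := ((((hasDerivAt_id y).const_mul c).neg.exp)).add
      ((hasDerivAt_id y).mul ((Real.hasDerivAt_log hy.ne').const_sub 1))
    refine this.congr_deriv ?_
    have e : y * -y⁻¹ = -1 := by field_simp
    simp only [id, Pi.neg_apply]
    rw [e]
    ring
  rcases lt_or_gt_of_ne hne with h | h
  · have : StrictMonoOn (fun y : ℝ => Real.exp (-(c*y)) + y * (1 - Real.log y)) (Ioc 0 y0) := by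
      apply strictMonoOn_of_deriv_pos (convex_Ioc 0 y0)
      · intro z hz
        exact (hd z hz.1).continuousAt.continuousWithinAt
      · intro z hz
        rw [interior_Ioc] at hz
        rw [(hd z hz.1).deriv]
        have := hm (show z ∈ Ioi 0 from hz.1) (show y0 ∈ Ioi 0 from h0) hz.2
        simp only at this
        linarith
    exact this ⟨hy, h.le⟩ ⟨h0, le_rfl⟩ h
  · have : StrictAntiOn (fun y : ℝ => Real.exp (-(c*y)) + y * (1 - Real.log y)) (Ici y0) := by
      apply strictAntiOn_of_deriv_neg (convex_Ici y0)
      · intro z hz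
        exact (hd z (h0.trans_le hz)).continuousAt.continuousWithinAt
      · intro z hz
        rw [interior_Ici] at hz
        have hz : y0 < z := hz
        rw [(hd z (h0.trans hz)).deriv]
        have := hm (show y0 ∈ Ioi 0 from h0) (show z ∈ Ioi 0 from h0.trans hz) hz
        simp only at this
        linarith
    exact this (show y0 ∈ Ici y0 from le_refl y0) (show y ∈ Ici y0 from h.le) h

lemma aux_fix (c : ℝ) (hc : 0 < c) : ∃ y ∈ Ioo (0:ℝ) 1, y = Real.exp (-(c*y)) := by
  have hcont : ContinuousOn (fun y : ℝ => y - Real.exp (-(c*y))) (Icc 0 1) := by fun_prop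
  have h := intermediate_value_Ioo (zero_le_one) hcont
  have h1 : Real.exp (-(c*1)) < 1 := by rw [Real.exp_lt_one_iff]; linarith
  obtain ⟨y, hy, hyz⟩ := h (show (0:ℝ) ∈ _ from ⟨by simp, by simpa using h1⟩)
  exact ⟨y, hy, by simp only at hyz; linarith⟩

/-- For `2α(1−B/2) < e`, `Φ_TS` has a unique maximizer `y* ∈ (0,1)` over `(0,1]`,
satisfying `ln y* = −2α(1−B/2)e^{−2α(1−B/2)y*}` and `y* = e^{−2α(1−B/2)y*}`. -/
theorem PhiTS_unique_maximizer (B α : ℝ) (hB : B ∈ Ioo (0:ℝ) 1) (hα : 0 < α)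
    (hcrit : 2*α*(1 - B/2) < Real.exp 1) :
    ∃ ystar : ℝ, ystar ∈ Ioo (0:ℝ) 1 ∧
      (∀ y ∈ Ioc (0:ℝ) 1, PhiTS B α y ≤ PhiTS B α ystar) ∧
      (∀ y ∈ Ioc (0:ℝ) 1, (∀ z ∈ Ioc (0:ℝ) 1, PhiTS B α z ≤ PhiTS B α y) → y = ystar) ∧
      Real.log ystar = -(2*α*(1 - B/2)) * Real.exp (-(2*α*(1 - B/2)*ystar)) ∧
      ystar = Real.exp (-(2*α*(1 - B/2)*ystar)) := by
  have hb : 0 < 1 - B/2 := by linarith [hB.2]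
  have hc : 0 < 2*α*(1 - B/2) := by positivity
  obtain ⟨y0, hy0, hfix⟩ := aux_fix _ hc
  have hlog : Real.log y0 = -(2*α*(1 - B/2)) * Real.exp (-(2*α*(1 - B/2)*y0)) := by
    rw [← hfix]
    conv_lhs => rw [hfix, Real.log_exp]
    ring
  have key : ∀ y, 0 < y → y ≠ y0 → PhiTS B α y < PhiTS B α y0 := by
    intro y hy hne
    have := aux_max_s9 _ hc hcrit y0 hy0.1 (by rw [hlog]; ring) y hy hne
    have := mul_lt_mul_of_pos_left this hb
    unfold PhiTS
    linarith
  refine ⟨y0, hy0, ?_, ?_, hlog, hfix⟩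
  · intro y hy
    by_cases h : y = y0
    · rw [h]
    · exact (key y hy.1 h).le
  · intro y hy hmax
    by_contra h
    exact absurd (hmax y0 ⟨hy0.1, hy0.2.le⟩) (not_le.mpr (key y hy.1 h))
end

section
/- Fix B = 1 and α, α_f ≥ 0. Then the maximum of F_TS over the square [0,1]² equals the supremum of F_TS over the quadrant [0,∞)²: max_{(t₁,t₂)∈[0,1]²} F_TS(t₁,t₂) = sup_{(t₁,t₂)∈[0,∞)²} F_TS(t₁,t₂). In particular, F_TS is non-increasing in t₁ for t₁ ≥ 1 (for each fixed t₂ ≥ 0) and non-increasing in t₂ for t₂ ≥ 1 (for each fixed t₁ ≥ 0). -/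
open Set

/-- One-variable monotonicity beyond `1`. -/
theorem aux_anti_s10 (a c p q m : ℝ) (ha : 0 ≤ a) (hc : 0 ≤ c) (hp : 0 ≤ p) (hp1 : p ≤ 1)
    (hq : 0 ≤ q) (hq1 : q ≤ 1) (hm : m = a + c) (s t : ℝ) (hs : 1 ≤ s) (hst : s ≤ t) :
    p * Real.exp (-(a * Real.exp (-(m * t)))) + q * Real.exp (-(c * Real.exp (-(m * t))))
      + Real.exp (-(m * t)) * (1 + m * t)
    ≤ p * Real.exp (-(a * Real.exp (-(m * s)))) + q * Real.exp (-(c * Real.exp (-(m * s))))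
      + Real.exp (-(m * s)) * (1 + m * s) := by
  have hder : ∀ x : ℝ, HasDerivAt (fun t => p * Real.exp (-(a * Real.exp (-(m * t))))
      + q * Real.exp (-(c * Real.exp (-(m * t)))) + Real.exp (-(m * t)) * (1 + m * t))
      (m * Real.exp (-(m * x)) * (a * (p * Real.exp (-(a * Real.exp (-(m * x)))))
        + c * (q * Real.exp (-(c * Real.exp (-(m * x))))) - m * x)) x := by
    intro x
    have h0 : HasDerivAt (fun t : ℝ => m * t) (m * 1) x := (hasDerivAt_id x).const_mul m
    have he := h0.neg.exp
    have h1 := ((he.const_mul a).neg.exp).const_mul p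
    have h2 := ((he.const_mul c).neg.exp).const_mul q
    have h3 := he.mul (h0.const_add 1)
    refine ((h1.add h2).add h3).congr_deriv ?_
    simp only [Pi.neg_apply]
    ring
  have hanti : AntitoneOn (fun t => p * Real.exp (-(a * Real.exp (-(m * t))))
      + q * Real.exp (-(c * Real.exp (-(m * t)))) + Real.exp (-(m * t)) * (1 + m * t))
      (Ici 1) := by
    apply antitoneOn_of_deriv_nonpos (convex_Ici 1)
    · exact fun x _ => (hder x).continuousAt.continuousWithinAt
    · exact fun x _ => (hder x).differentiableAt.differentiableWithinAt
    · intro x hx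
      rw [interior_Ici] at hx
      have hx1 : 1 < x := hx
      rw [(hder x).deriv]
      have hm0 : 0 ≤ m := by linarith
      have key : ∀ a p : ℝ, 0 ≤ a → 0 ≤ p → p ≤ 1 →
          a * (p * Real.exp (-(a * Real.exp (-(m * x))))) ≤ a := by
        intro a p ha hp hp1
        have h1 : Real.exp (-(a * Real.exp (-(m * x)))) ≤ 1 := by
          rw [Real.exp_le_one_iff]
          have := mul_nonneg ha (Real.exp_pos (-(m * x))).le
          linarith
        have h2 : p * Real.exp (-(a * Real.exp (-(m * x)))) ≤ 1 :=
          mul_le_one₀ hp1 (Real.exp_pos _).le h1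
        exact mul_le_of_le_one_right ha h2
      have k1 := key a p ha hp hp1
      have k2 := key c q hc hq hq1
      have k3 : m ≤ m * x := le_mul_of_one_le_right hm0 hx1.le
      apply mul_nonpos_of_nonneg_of_nonpos (mul_nonneg hm0 (Real.exp_pos _).le)
      linarith
  exact hanti (mem_Ici.2 hs) (mem_Ici.2 (hs.trans hst)) hst

theorem aux_exp_le (a y : ℝ) (ha : 0 ≤ a) : Real.exp (-(a * Real.exp y)) ≤ 1 := by
  rw [Real.exp_le_one_iff]
  have := mul_nonneg ha (Real.exp_pos y).le
  linarith

theorem FTS_one (α αf t₁ t₂ : ℝ) : FTS 1 α αf t₁ t₂ =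
    (Real.exp (-((α + αf)/2 * Real.exp (-(M2 1 α αf * t₂))))
        * Real.exp (-(α * Real.exp (-(M1 1 α αf * t₁))))
      + Real.exp (-(αf * Real.exp (-(M2 1 α αf * t₂))))
        * Real.exp (-((α + αf)/2 * Real.exp (-(M1 1 α αf * t₁))))
      + Real.exp (-(M1 1 α αf * t₁)) * (1 + M1 1 α αf * t₁)
      + Real.exp (-(M2 1 α αf * t₂)) * (1 + M2 1 α αf * t₂)) / 2 - 1 := by
  rw [← Real.exp_add, ← Real.exp_add]
  unfold FTS
  ring_nf

/-- At `B = 1`, the maximum of `F_TS` over `[0,1]²` equals its supremum over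
`[0,∞)²`; in particular `F_TS` is non-increasing in each coordinate beyond `1`. -/
theorem domain_extension (α αf : ℝ) (hα : 0 ≤ α) (hαf : 0 ≤ αf) :
    maxTS 1 α αf =
      sSup ((fun p : ℝ × ℝ => FTS 1 α αf p.1 p.2) '' (Ici 0 ×ˢ Ici 0)) ∧
    (∀ t₂ : ℝ, 0 ≤ t₂ → ∀ s t : ℝ, 1 ≤ s → s ≤ t →
      FTS 1 α αf t t₂ ≤ FTS 1 α αf s t₂) ∧
    (∀ t₁ : ℝ, 0 ≤ t₁ → ∀ s t : ℝ, 1 ≤ s → s ≤ t →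
      FTS 1 α αf t₁ t ≤ FTS 1 α αf t₁ s) := by
  have h1 : ∀ t₂ : ℝ, 0 ≤ t₂ → ∀ s t : ℝ, 1 ≤ s → s ≤ t →
      FTS 1 α αf t t₂ ≤ FTS 1 α αf s t₂ := by
    intro t₂ _ s t hs hst
    have := aux_anti_s10 α ((α + αf)/2) (Real.exp (-((α + αf)/2 * Real.exp (-(M2 1 α αf * t₂)))))
      (Real.exp (-(αf * Real.exp (-(M2 1 α αf * t₂))))) (M1 1 α αf) hα (by linarith)
      (Real.exp_pos _).le (aux_exp_le _ _ (by linarith)) (Real.exp_pos _).le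
      (aux_exp_le _ _ hαf) (by unfold M1; ring) s t hs hst
    rw [FTS_one, FTS_one]
    linarith
  have h2 : ∀ t₁ : ℝ, 0 ≤ t₁ → ∀ s t : ℝ, 1 ≤ s → s ≤ t →
      FTS 1 α αf t₁ t ≤ FTS 1 α αf t₁ s := by
    intro t₁ _ s t hs hst
    have := aux_anti_s10 ((α + αf)/2) αf (Real.exp (-(α * Real.exp (-(M1 1 α αf * t₁)))))
      (Real.exp (-((α + αf)/2 * Real.exp (-(M1 1 α αf * t₁))))) (M2 1 α αf) (by linarith) hαf
      (Real.exp_pos _).le (aux_exp_le _ _ hα) (Real.exp_pos _).le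
      (aux_exp_le _ _ (by linarith)) (by unfold M2; ring) s t hs hst
    rw [FTS_one, FTS_one]
    linarith
  refine ⟨?_, h1, h2⟩
  unfold maxTS
  apply csSup_eq_csSup_of_forall_exists_le
  · rintro _ ⟨⟨x, y⟩, ⟨hx, hy⟩, rfl⟩
    exact ⟨_, ⟨(x, y), ⟨hx.1, hy.1⟩, rfl⟩, le_rfl⟩
  · rintro _ ⟨⟨x, y⟩, ⟨hx, hy⟩, rfl⟩
    have hx0 : 0 ≤ x := hx
    have hy0 : 0 ≤ y := hy
    have hx' : 0 ≤ min x 1 := le_min hx0 zero_le_one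
    refine ⟨_, ⟨(min x 1, min y 1), ⟨⟨hx', min_le_right _ _⟩,
      ⟨le_min hy0 zero_le_one, min_le_right _ _⟩⟩, rfl⟩, ?_⟩
    have e1 : FTS 1 α αf x y ≤ FTS 1 α αf (min x 1) y := by
      rcases le_total x 1 with h | h
      · rw [min_eq_left h]
      · rw [min_eq_right h]; exact h1 y hy0 1 x le_rfl h
    have e2 : FTS 1 α αf (min x 1) y ≤ FTS 1 α αf (min x 1) (min y 1) := by
      rcases le_total y 1 with h | h
      · rw [min_eq_left h]
      · rw [min_eq_right h]; exact h2 _ hx' 1 y le_rfl h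
    exact e1.trans e2
end

section
/- Let B ∈ (0,1), α ≥ 0, and α_f > 0. Define m_reg = 2(1−B/2)(1 − (1−B/2)α − e^{−2α(1−B/2)}), C_FMZ = (2/α_f)(e^{α_f B/2} − 1)·exp(−α_f(1−B/2)·e^{−2α(1−B/2)}), and L_FMZ = m_reg + B − C_FMZ. Then max_{(t₁,t₂)∈[0,1]²} F_TS(t₁,t₂) ≤ 1 − L_FMZ. (Equivalently, the two-sided matching rate η_TS = 1 − max F_TS satisfies η_TS ≥ L_FMZ.) -/
open Set

/-- `m_reg = 2(1−B/2)(1 − (1−B/2)α − e^{−2α(1−B/2)})`. -/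
noncomputable def mreg (B α : ℝ) : ℝ :=
  2 * (1 - B/2) * (1 - (1 - B/2)*α - Real.exp (-(2*α*(1 - B/2))))

/-- `C_FMZ = (2/α_f)(e^{α_f B/2} − 1)·e^{−α_f(1−B/2)e^{−2α(1−B/2)}}`. -/
noncomputable def CFMZ (B α αf : ℝ) : ℝ :=
  (2/αf) * (Real.exp (αf*B/2) - 1) *
    Real.exp (-(αf*(1 - B/2)*Real.exp (-(2*α*(1 - B/2)))))


/-- Weighted tangent inequality: `x(1 - log x) ≤ e^{-s} + x s`. -/
lemma aux_tangent (x s : ℝ) (hx : 0 < x) :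
    x * (1 - Real.log x) ≤ Real.exp (-s) + x * s := by
  have h := Real.add_one_le_exp (-s - Real.log x)
  have e : Real.exp (-s) = x * Real.exp (-s - Real.log x) := by
    rw [Real.exp_sub, Real.exp_log hx]; field_simp
  rw [e]
  nlinarith

lemma aux_core_big (U r : ℝ) (hU : 0 < U) (hr : 2/5 ≤ r) (hr1 : r ≤ 1) :
    Real.exp (-U) - Real.exp (-(U*r)) * (1 - U*(1-r)) ≤ U*(1 - r + r * Real.log r) := by
  have hr0 : 0 < r := by linarith
  have hd : 0 ≤ U*(1-r) := mul_nonneg hU.le (by linarith)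
  have e1 : Real.exp (-U) = Real.exp (-(U*r)) * Real.exp (-(U*(1-r))) := by
    rw [← Real.exp_add]; congr 1; ring
  have e2 : Real.exp (-(U*(1-r))) ≤ 1 - U*(1-r) + (U*(1-r))^2/2 := by
    generalize U*(1-r) = d at hd
    have h := Real.quadratic_le_exp_of_nonneg hd
    have h2 : Real.exp (-d) * Real.exp d = 1 := by rw [← Real.exp_add]; simp
    have h3 := Real.exp_pos (-d)
    have h4 := Real.exp_pos d
    have h6 : 0 ≤ 1 - d + d^2/2 := by nlinarith [sq_nonneg (d-1)]
    have h5 : 1 ≤ (1 - d + d^2/2) * Real.exp d := by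
      nlinarith [mul_le_mul_of_nonneg_left h h6, sq_nonneg (d^2)]
    by_contra hc
    push Not at hc
    nlinarith [mul_lt_mul_of_pos_right hc h4]
  have e3 : U * Real.exp (-(U*r)) ≤ 1 := by
    have h := Real.add_one_le_exp (U*r-1)
    have h1 : Real.exp (U*r) = Real.exp 1 * Real.exp (U*r-1) := by
      rw [← Real.exp_add]; congr 1; ring
    have h2 := Real.exp_one_gt_d9
    have h7 : 0 < U*r := by positivity
    have h3 : U ≤ Real.exp (U*r) := by
      rw [h1]
      have h8 : 2.7 * (U*r) ≤ Real.exp 1 * Real.exp (U*r-1) := by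
        apply mul_le_mul _ _ h7.le (Real.exp_pos _).le <;> linarith
      nlinarith
    have h4 : Real.exp (-(U*r)) * Real.exp (U*r) = 1 := by rw [← Real.exp_add]; simp
    nlinarith [Real.exp_pos (-(U*r))]
  have e4 : (r^2 - 1)/2 ≤ r * Real.log r := by
    have h : 0 ≤ Real.log r⁻¹ := Real.log_nonneg ((one_le_inv₀ hr0).2 hr1)
    have h1 := Real.self_le_sinh_iff.2 h
    rw [Real.sinh_log (by positivity), Real.log_inv, inv_inv] at h1
    have h2 := mul_le_mul_of_nonneg_left h1 hr0.le
    have h3 : r * ((r⁻¹ - r)/2) = (1 - r^2)/2 := by field_simp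
    rw [h3] at h2
    linarith
  have hE := Real.exp_pos (-(U*r))
  have e5 := mul_le_mul_of_nonneg_left e2 hE.le
  have e6 : (U * Real.exp (-(U*r))) * (U*(1-r)^2/2) ≤ 1 * (U*(1-r)^2/2) :=
    mul_le_mul_of_nonneg_right e3 (by positivity)
  have e7 := mul_le_mul_of_nonneg_left e4 hU.le
  rw [e1]
  nlinarith

lemma aux_core_small (U r : ℝ) (hU : 0 < U) (hr0 : 0 < r) (hr1 : r ≤ 2/5) :
    Real.exp (-U) - Real.exp (-(U*r)) * (1 - U*(1-r)) ≤ U*(1 - r + r * Real.log r) := by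
  have hd : 0 ≤ U*(1-r) := mul_nonneg hU.le (by linarith)
  have e1 : Real.exp (-U) = Real.exp (-(U*r)) * Real.exp (-(U*(1-r))) := by
    rw [← Real.exp_add]; congr 1; ring
  have inv_bd : ∀ d : ℝ, 0 ≤ d → Real.exp (-d) ≤ 1/(1+d) := by
    intro d hd
    rw [Real.exp_neg, ← one_div]
    apply one_div_le_one_div_of_le (by linarith)
    linarith [Real.add_one_le_exp d]
  obtain ⟨p, hp, hpr⟩ : ∃ p : ℝ, 0 < p ∧ p^4 = r := by
    refine ⟨√(√r), by positivity, ?_⟩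
    have : √(√r)^4 = (√(√r)^2)^2 := by ring
    rw [this, Real.sq_sqrt (by positivity), Real.sq_sqrt hr0.le]
  have hp1 : p ≤ 0.8 := by
    by_contra h
    push Not at h
    have : (0.8:ℝ)^4 < p^4 := pow_lt_pow_left₀ h (by norm_num) (by norm_num)
    norm_num at this
    linarith
  have hlog : 4*(p^4 - p^3) ≤ r * Real.log r := by
    rw [← hpr, Real.log_pow]
    have h := Real.one_sub_inv_le_log_of_pos hp
    have h2 := mul_le_mul_of_nonneg_left h (by positivity : 0 ≤ 4*p^4)
    have h3 : 4*p^4*(1-p⁻¹) = 4*(p^4-p^3) := by field_simp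
    rw [h3] at h2
    push_cast
    linarith
  have hk : (1-r)^2 ≤ (1 - r + r*Real.log r) * (1 + 1.54*p^2) := by
    have h : (1-r)^2 ≤ (1-4*p^3+3*p^4)*(1+1.54*p^2) := by
      rw [← hpr]
      have hq : 0 ≤ 1.54 - 0.92*p+1.62*p^2-2*p^3-p^4 := by
        have h2 : p^2 ≤ 0.64 := by nlinarith
        have h3 : p^3 ≤ 0.64*p := by nlinarith
        have h4 : p^4 ≤ 0.64*p^2 := by nlinarith
        nlinarith
      have h5 : 0 ≤ (1-p)^2*p^2*(1.54 - 0.92*p+1.62*p^2-2*p^3-p^4) := by positivity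
      nlinarith
    refine h.trans (mul_le_mul_of_nonneg_right ?_ (by positivity))
    linarith
  have hE := Real.exp_pos (-(U*r))
  have hUr : 0 < U*r := by positivity
  have e2 := inv_bd _ hd
  have e3 := inv_bd _ hUr.le
  have e4 : Real.exp (-(U*(1-r))) - (1 - U*(1-r)) ≤ (U*(1-r))^2/(1+U*(1-r)) := by
    have : (U*(1-r))^2/(1+U*(1-r)) = 1/(1+U*(1-r)) - (1 - U*(1-r)) := by
      field_simp; ring
    linarith
  have e5 : Real.exp (-(U*r)) * (Real.exp (-(U*(1-r))) - (1 - U*(1-r)))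
      ≤ 1/(1+U*r) * ((U*(1-r))^2/(1+U*(1-r))) := by
    refine (mul_le_mul_of_nonneg_left e4 hE.le).trans ?_
    exact mul_le_mul_of_nonneg_right e3 (by positivity)
  have e6 : 1/(1+U*r) * ((U*(1-r))^2/(1+U*(1-r))) ≤ U*(1 - r + r * Real.log r) := by
    rw [div_mul_div_comm, one_mul, div_le_iff₀ (by positivity)]
    have hk0 : 0 ≤ 1 - r + r*Real.log r := by
      by_contra hc
      push Not at hc
      have : (1 - r + r*Real.log r) * (1 + 1.54*p^2) < 0 :=
        mul_neg_of_neg_of_pos hc (by positivity)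
      nlinarith [sq_nonneg (1-r)]
    have h1 : U*(1+1.54*p^2) ≤ (1+U*r)*(1+U*(1-r)) := by
      have h2 : (p^2)^2 = r := by rw [← hpr]; ring
      have h3 : 0 ≤ U^2*r*(3/5 - (1-(2/5))) := by norm_num
      have h4 : U^2*r*(3/5) ≤ U^2*r*(1-r) :=
        mul_le_mul_of_nonneg_left (by linarith) (by positivity)
      have h5 : 1.54*(U*p^2) ≤ 1 + 0.6*(U*p^2)^2 := by nlinarith [sq_nonneg (U*p^2 - 1.29)]
      have h6 : (U*p^2)^2 = U^2*r := by rw [mul_pow, h2]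
      nlinarith
    have h2 : U^2*(1-r)^2 ≤ U^2*((1 - r + r*Real.log r) * (1 + 1.54*p^2)) :=
      mul_le_mul_of_nonneg_left hk (by positivity)
    have h3 := mul_le_mul_of_nonneg_left h1 (mul_nonneg hU.le hk0)
    nlinarith
  rw [e1]
  nlinarith

lemma aux_core_s11 (U r : ℝ) (hU : 0 < U) (hr0 : 0 < r) (hr1 : r ≤ 1) :
    Real.exp (-U) - Real.exp (-(U*r)) * (1 - U*(1-r)) ≤ U*(1 - r + r * Real.log r) := by
  rcases le_total (2/5) r with h | h
  · exact aux_core_big U r hU h hr1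
  · exact aux_core_small U r hU hr0 h

/-- The regular/flexible interaction in the first variable. -/
lemma aux_x (u v l x : ℝ) (hu : 0 < u) (hv : 0 < v) (hl : 0 ≤ l) (hx : 0 < x) (hx1 : x ≤ 1) :
    u * Real.exp (-(l*x)) + v * Real.exp (-(u*x)) + u * (x * (1 - Real.log x))
      ≤ 2*u*Real.exp (-l) + l*u + (Real.exp v - 1) * Real.exp (-(u*Real.exp (-l))) := by
  set z := Real.exp (-l) with hz
  have hz0 : 0 < z := Real.exp_pos _
  have hzl : 1 - l ≤ z := by linarith [Real.add_one_le_exp (-l)]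
  have hlz : Real.log z = -l := Real.log_exp _
  have hchord : Real.exp (-(l*x)) ≤ 1 - x + x*z := by
    have h := convexOn_exp.2 (Set.mem_univ (0:ℝ)) (Set.mem_univ (-l))
      (by linarith : 0 ≤ 1 - x) hx.le (by ring)
    simp only [smul_eq_mul, mul_zero, zero_add, Real.exp_zero, mul_one] at h
    rw [show -(l*x) = x * -l by ring]
    exact h
  have hreg : Real.exp (-(l*x)) ≤ z + l - l*x := by
    nlinarith [mul_nonneg (by linarith : 0 ≤ 1-x) (by linarith : 0 ≤ z + l - 1)]
  have hev := Real.add_one_le_exp v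
  rcases le_total z x with h | h
  · have h1 := aux_tangent x l hx
    rw [← hz] at h1
    have h2 : Real.exp (-(u*x)) ≤ Real.exp (-(u*z)) :=
      Real.exp_le_exp.2 (by nlinarith)
    have h3 := Real.exp_pos (-(u*z))
    nlinarith [mul_le_mul_of_nonneg_left h2 hv.le, mul_le_mul_of_nonneg_left h1 hu.le,
      mul_le_mul_of_nonneg_left hreg hu.le, mul_le_mul_of_nonneg_right hev h3.le]
  · have hc := aux_core_s11 (u*z) (x/z) (by positivity) (by positivity) ((div_le_one hz0).2 h)
    rw [Real.log_div hx.ne' hz0.ne', hlz] at hc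
    rw [show u*z*(x/z) = u*x by field_simp,
      show u*z*(1-x/z) = u*(z-x) by field_simp,
      show u*z*(1-x/z+x/z*(Real.log x - -l)) = u*(z-x+x*(Real.log x + l)) by
        field_simp; ring] at hc
    have h1 : Real.exp v * Real.exp (-(u*z)) = Real.exp (-(u*x)) * Real.exp (v - u*(z-x)) := by
      rw [← Real.exp_add, ← Real.exp_add]; congr 1; ring
    have h2 := mul_le_mul_of_nonneg_left (Real.add_one_le_exp (v - u*(z-x)))
      (Real.exp_pos (-(u*x))).le
    nlinarith [mul_le_mul_of_nonneg_left hreg hu.le]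

/-- Monotonicity step for the second variable. -/
lemma aux_mono_s11 (u β : ℝ) (hu : 0 < u) (hβ : u ≤ β) :
    (1 - Real.exp (-u)) * Real.log (Real.exp u - 1) - u * Real.log u
      ≤ (1 - Real.exp (-u)) * Real.log (Real.exp β - 1) - u * Real.log β := by
  have hpos : ∀ t : ℝ, 0 < t → 0 < Real.exp t - 1 := fun t ht => by
    linarith [Real.add_one_le_exp t]
  have hder : ∀ t : ℝ, 0 < t → HasDerivAt
      (fun t => (1 - Real.exp (-u)) * Real.log (Real.exp t - 1) - u * Real.log t)
      ((1 - Real.exp (-u)) * (Real.exp t / (Real.exp t - 1)) - u * t⁻¹) t := by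
    intro t ht
    exact ((((Real.hasDerivAt_exp t).sub_const 1).log (hpos t ht).ne').const_mul _).sub
      ((Real.hasDerivAt_log ht.ne').const_mul u)
  have hm : MonotoneOn
      (fun t => (1 - Real.exp (-u)) * Real.log (Real.exp t - 1) - u * Real.log t) (Ici u) := by
    apply monotoneOn_of_deriv_nonneg (convex_Ici u)
    · intro t ht
      exact (hder t (lt_of_lt_of_le hu ht)).continuousAt.continuousWithinAt
    · intro t ht
      rw [interior_Ici] at ht
      exact (hder t (hu.trans ht)).differentiableAt.differentiableWithinAt
    · intro t ht
      rw [interior_Ici] at ht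
      have hut : u < t := ht
      have ht0 : 0 < t := hu.trans hut
      rw [(hder t ht0).deriv]
      have h := convexOn_exp.2 (Set.mem_univ (0:ℝ)) (Set.mem_univ (-t))
        (sub_nonneg.2 ((div_le_one ht0).2 hut.le) : 0 ≤ 1 - u/t) (by positivity : 0 ≤ u/t) (by ring)
      simp only [smul_eq_mul, mul_zero, zero_add, Real.exp_zero, mul_one] at h
      rw [show u/t * -t = -u by field_simp] at h
      have hp := hpos t ht0
      have h1 : u/t*(1 - Real.exp (-t)) ≤ 1 - Real.exp (-u) := by linarith
      have h2 := mul_le_mul_of_nonneg_right h1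
        (by positivity : 0 ≤ Real.exp t / (Real.exp t - 1))
      have h3 : (1 - Real.exp (-t)) * (Real.exp t / (Real.exp t - 1)) = 1 := by
        rw [Real.exp_neg]; field_simp
      rw [mul_assoc, h3] at h2
      rw [← div_eq_mul_inv]
      linarith
  exact hm (Set.mem_Ici.2 le_rfl) (Set.mem_Ici.2 hβ) hβ

lemma aux_y (K β y : ℝ) (hβ : 0 < β) (hy : 0 < y) (hy1 : y ≤ 1) :
    K * (Real.exp (-(β*y)) - 1) + β * (y * (1 - Real.log y))
      ≤ (Real.exp β - 1) * Real.exp (-K) := by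
  have hu : 0 < β*y := by positivity
  have hm := aux_mono_s11 (β*y) β hu (by nlinarith)
  have hβ1 : 0 < Real.exp β - 1 := by linarith [Real.add_one_le_exp β]
  have hu1 : 0 < Real.exp (β*y) - 1 := by linarith [Real.add_one_le_exp (β*y)]
  rw [Real.log_mul hβ.ne' hy.ne'] at hm
  generalize hu' : β*y = u at *
  have hP : 1 - Real.exp (-u) = (Real.exp u - 1) * Real.exp (-u) := by
    rw [sub_mul, ← Real.exp_add]; simp
  have hP0 : 0 < 1 - Real.exp (-u) := by rw [hP]; positivity
  have hlP : Real.log (1 - Real.exp (-u)) = Real.log (Real.exp u - 1) - u := by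
    rw [hP, Real.log_mul hu1.ne' (Real.exp_pos _).ne', Real.log_exp]; ring
  have ht := aux_tangent ((1 - Real.exp (-u))/(Real.exp β - 1)) K (by positivity)
  rw [Real.log_div hP0.ne' hβ1.ne', hlP] at ht
  have ht2 := mul_le_mul_of_nonneg_left ht hβ1.le
  have e : ∀ w : ℝ, (Real.exp β - 1) * ((1 - Real.exp (-u))/(Real.exp β - 1) * w)
      = (1 - Real.exp (-u)) * w := by intro w; field_simp
  rw [mul_add, e, e] at ht2
  have hP2 : u ≤ (1 - Real.exp (-u)) * (1+u) := by
    have h1 := Real.add_one_le_exp u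
    have h2 : Real.exp (-u) * Real.exp u = 1 := by rw [← Real.exp_add]; simp
    nlinarith [mul_le_mul_of_nonneg_left h1 (Real.exp_pos (-u)).le]
  have e2 : β * (y * (1 - Real.log y)) = u * (1 - Real.log y) := by rw [← hu']; ring
  rw [e2]
  nlinarith

/-- The main inequality in the variables `x = e^{-M₁t₁}`, `y = e^{-M₂t₂}`. -/
lemma aux_main (a b α f x y : ℝ) (ha : 0 < a) (hb : 0 < b) (hα : 0 ≤ α) (hf : 0 < f)
    (hx : 0 < x) (hx1 : x ≤ 1) (hy : 0 < y) (hy1 : y ≤ 1) :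
    a * Real.exp (-(2*α*a*x) - (α+f)*b*y) + b * Real.exp (-((α+f)*a*x) - 2*f*b*y)
      + a * (x * (1 - Real.log x)) + b * (y * (1 - Real.log y))
    ≤ 2*a*Real.exp (-(2*α*a)) + 2*α*a^2
      + (2/f) * (Real.exp (f*b) - 1) * Real.exp (-(f*a*Real.exp (-(2*α*a)))) := by
  have h1 := aux_x (f*a) (f*b) (2*α*a) x (by positivity) (by positivity) (by positivity) hx hx1
  have h2 := aux_y (f*a*Real.exp (-(2*α*a*x))) (f*b) y (by positivity) hy hy1
  have hz : Real.exp (-(2*α*a)) ≤ Real.exp (-(2*α*a*x)) := by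
    apply Real.exp_le_exp.2
    nlinarith [mul_nonneg (by positivity : 0 ≤ 2*α*a) (by linarith : 0 ≤ 1 - x)]
  have hfa : 0 < f*a := by positivity
  have h3 : Real.exp (-(f*a*Real.exp (-(2*α*a*x)))) ≤ Real.exp (-(f*a*Real.exp (-(2*α*a)))) := by
    apply Real.exp_le_exp.2
    nlinarith [mul_le_mul_of_nonneg_left hz hfa.le]
  have hfb : 0 < Real.exp (f*b) - 1 := by
    have : 0 < f*b := by positivity
    linarith [Real.add_one_le_exp (f*b)]
  have h4 := mul_le_mul_of_nonneg_left h3 hfb.le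
  have h5 : Real.exp (-(2*α*a*x) - (α+f)*b*y)
      ≤ Real.exp (-(2*α*a*x)) * Real.exp (-(f*b*y)) := by
    rw [← Real.exp_add]
    apply Real.exp_le_exp.2
    have : 0 ≤ α*b*y := by positivity
    nlinarith
  have h6 : Real.exp (-((α+f)*a*x) - 2*f*b*y) ≤ Real.exp (-(f*a*x)) := by
    apply Real.exp_le_exp.2
    have : 0 ≤ α*a*x := by positivity
    have : 0 ≤ f*b*y := by positivity
    nlinarith
  have h7 := mul_le_mul_of_nonneg_left h5 hfa.le
  have h8 := mul_le_mul_of_nonneg_left h6 (by positivity : 0 ≤ f*b)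
  refine le_of_mul_le_mul_left ?_ hf
  have e : f * ((2/f) * (Real.exp (f*b) - 1) * Real.exp (-(f*a*Real.exp (-(2*α*a)))))
      = 2 * ((Real.exp (f*b) - 1) * Real.exp (-(f*a*Real.exp (-(2*α*a))))) := by
    field_simp
  rw [mul_add f (2*a*Real.exp (-(2*α*a)) + 2*α*a^2), e]
  linarith

/-- The two-sided objective is bounded: `max F_TS ≤ 1 − L_FMZ` where
`L_FMZ = m_reg + B − C_FMZ` (equivalently `η_TS ≥ L_FMZ`). -/
theorem TS_lower_bound (B α αf : ℝ) (hB : B ∈ Ioo (0:ℝ) 1) (hα : 0 ≤ α)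
    (hαf : 0 < αf) :
    maxTS B α αf ≤ 1 - (mreg B α + B - CFMZ B α αf) := by
  obtain ⟨hB0, hB1⟩ := hB
  apply csSup_le
  · exact ⟨_, ⟨(0, 0), by simp, rfl⟩⟩
  rintro _ ⟨⟨t₁, t₂⟩, ⟨ht1, ht2⟩, rfl⟩
  have hM1 : 0 ≤ M1 B α αf := by
    unfold M1
    exact add_nonneg (mul_nonneg (by linarith) hα) (by positivity)
  have hM2 : 0 ≤ M2 B α αf := by
    unfold M2
    exact add_nonneg (mul_nonneg (by linarith) hα) (by positivity)
  have hx1 : Real.exp (-(M1 B α αf * t₁)) ≤ 1 :=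
    Real.exp_le_one_iff.2 (neg_nonpos.2 (mul_nonneg hM1 ht1.1))
  have hy1 : Real.exp (-(M2 B α αf * t₂)) ≤ 1 :=
    Real.exp_le_one_iff.2 (neg_nonpos.2 (mul_nonneg hM2 ht2.1))
  have h := aux_main (1 - B/2) (B/2) α αf _ _ (by linarith) (by linarith) hα hαf
    (Real.exp_pos _) hx1 (Real.exp_pos _) hy1
  rw [Real.log_exp, Real.log_exp] at h
  simp only [FTS, mreg, CFMZ]
  rw [show αf*B = 2*αf*(B/2) by ring, show 2*αf*(B/2)/2 = αf*(B/2) by ring]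
  linarith
end

section
/- Let B ∈ (0,1), α ≥ 0, and α_f > 0. Set Γ = (1−B/2)·sup_{y∈(0,1]}(e^{−2α(1−B/2)y} + y(1 − ln y) − 1), M′₁ = (B/2)(α+α_f), M′₂ = Γ·(α+α_f), and define F_Cross(t₁,t₂) = Γ·exp(−M′₁·e^{−M′₂t₂}) + (B/2)·exp(−M′₂·e^{−M′₁t₁}) + Γ·e^{−M′₁t₁}(1+M′₁t₁) + (B/2)·e^{−M′₂t₂}(1+M′₂t₂) − (Γ + B/2). Then max_{(t₁,t₂)∈[0,1]²} F_TS(t₁,t₂) ≤ max_{(t₁,t₂)∈[0,1]²} F_Cross(t₁,t₂). -/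
open Set

/-- `Γ = (1−B/2)·sup_{y∈(0,1]}(e^{−2α(1−B/2)y} + y(1 − ln y) − 1)`. -/
noncomputable def Gam (B α : ℝ) : ℝ :=
  (1 - B/2) *
    sSup ((fun y => Real.exp (-(2*α*(1 - B/2)*y)) + y*(1 - Real.log y) - 1) '' Ioc 0 1)

/-- `M′₁ = (B/2)(α+α_f)`. -/
noncomputable def M1' (B α αf : ℝ) : ℝ := (B/2) * (α + αf)

/-- `M′₂ = Γ·(α+α_f)`. -/
noncomputable def M2' (B α αf : ℝ) : ℝ := Gam B α * (α + αf)

/-- The cross objective `F_Cross`. -/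
noncomputable def FCross (B α αf t₁ t₂ : ℝ) : ℝ :=
  Gam B α * Real.exp (-(M1' B α αf * Real.exp (-(M2' B α αf * t₂))))
  + (B/2) * Real.exp (-(M2' B α αf * Real.exp (-(M1' B α αf * t₁))))
  + Gam B α * Real.exp (-(M1' B α αf * t₁)) * (1 + M1' B α αf * t₁)
  + (B/2) * Real.exp (-(M2' B α αf * t₂)) * (1 + M2' B α αf * t₂)
  - (Gam B α + B/2)

/-- `v * log (v₀/v) ≤ v₀ - v`. -/
lemma mul_log_aux {v w : ℝ} (hv : 0 < v) (hw : 0 < w) :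
    v * (Real.log w - Real.log v) ≤ w - v := by
  have h := Real.log_le_sub_one_of_pos (div_pos hw hv)
  rw [Real.log_div hw.ne' hv.ne'] at h
  have h2 := mul_le_mul_of_nonneg_left h hv.le
  have h3 : v * (w / v - 1) = w - v := by field_simp
  linarith

/-- Restricting the variable to the range `[exp (-(p s)), 1]` loses nothing. -/
lemma range_aux {p q s v : ℝ} (hp : 0 < p) (hq : 0 < q) (hs : 0 < s) (hv : 0 < v) (hv1 : v ≤ 1) :
    ∃ t ∈ Icc (0:ℝ) 1, p * Real.exp (-(q * s * v)) + q * (v * (1 - Real.log v)) ≤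
      p * Real.exp (-(q * s * Real.exp (-(p * s * t))))
        + q * Real.exp (-(p * s * t)) * (1 + p * s * t) := by
  have hps : 0 < p * s := mul_pos hp hs
  have hqs : 0 < q * s := mul_pos hq hs
  by_cases h : Real.exp (-(p * s)) ≤ v
  · have hl : -(p * s) ≤ Real.log v := (Real.le_log_iff_exp_le hv).2 h
    have hl0 : Real.log v ≤ 0 := Real.log_nonpos hv.le hv1
    refine ⟨-Real.log v / (p * s), ⟨div_nonneg (by linarith) hps.le, ?_⟩, ?_⟩
    · rw [div_le_one hps]; linarith
    · have e : p * s * (-Real.log v / (p * s)) = -Real.log v := by field_simp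
      rw [e, neg_neg, Real.exp_log hv]
      apply le_of_eq; ring
  · push Not at h
    refine ⟨1, ⟨zero_le_one, le_rfl⟩, ?_⟩
    rw [mul_one]
    have hw := Real.exp_pos (-(p * s))
    have hlw : Real.log (Real.exp (-(p * s))) = -(p * s) := Real.log_exp _
    generalize Real.exp (-(p * s)) = w at *
    have h1 := mul_log_aux hv hw
    rw [hlw] at h1
    have h2 : Real.exp (-(q * s * v)) - Real.exp (-(q * s * w)) ≤ q * s * (w - v) := by
      have e : Real.exp (-(q * s * w))
          = Real.exp (-(q * s * v)) * Real.exp (-(q * s * (w - v))) := by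
        rw [← Real.exp_add]; congr 1; ring
      have h3 := Real.add_one_le_exp (-(q * s * (w - v)))
      have h4 : Real.exp (-(q * s * v)) ≤ 1 := Real.exp_le_one_iff.2 (by nlinarith)
      have h5 := Real.exp_pos (-(q * s * v))
      have h6 : 0 ≤ q * s * (w - v) := mul_nonneg hqs.le (by linarith)
      rw [e]
      nlinarith
    have h7 := mul_le_mul_of_nonneg_left h2 hp.le
    have h8 := mul_le_mul_of_nonneg_left h1 hq.le
    nlinarith

/-- The core inequality. -/
lemma core_aux {γ c x w : ℝ} (hγ : 0 < γ) (hγ1 : γ ≤ 1)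
    (hsup : ∀ y, 0 < y → y ≤ 1 → Real.exp (-(c * y)) + y * (1 - Real.log y) - 1 ≤ γ)
    (hx : 0 < x) (hx1 : x ≤ 1) (hw0 : 0 ≤ w) (hw1 : w ≤ 1) :
    ∃ u, 0 < u ∧ u ≤ 1 ∧ γ * u ≤ x ∧
      Real.exp (-(c * x)) * w + x * (1 - Real.log x) - 1
        ≤ γ * w - γ + γ * (u * (1 - Real.log u)) := by
  by_cases h : γ ≤ x
  · refine ⟨1, one_pos, le_rfl, by linarith, ?_⟩
    rw [Real.log_one]
    have h1 := mul_le_mul_of_nonneg_right (hsup x hx hx1) hw0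
    have h2 := mul_log_aux hx one_pos
    rw [Real.log_one] at h2
    nlinarith
  · push Not at h
    refine ⟨x / γ, div_pos hx hγ, (div_le_one hγ).2 h.le, ?_, ?_⟩
    · apply le_of_eq; field_simp
    · have e : γ * (x / γ * (1 - Real.log (x / γ))) = x * (1 - Real.log x + Real.log γ) := by
        rw [Real.log_div hx.ne' hγ.ne']; field_simp; ring
      rw [e]
      -- value at `w = 1`
      have hconv : Real.exp (-(c * x)) ≤ x / γ * Real.exp (-(c * γ)) + (1 - x / γ) := by
        have hθ : x / γ ≤ 1 := (div_le_one hγ).2 h.le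
        have := convexOn_exp.2 (mem_univ (-(c * γ))) (mem_univ 0)
          (div_pos hx hγ).le (sub_nonneg.2 hθ) (by ring)
        simp only [smul_eq_mul, mul_zero, add_zero, Real.exp_zero, mul_one] at this
        have e2 : x / γ * -(c * γ) = -(c * x) := by field_simp
        rwa [e2] at this
      have hg := hsup γ hγ hγ1
      have h1 : 0 ≤ x * Real.log γ + 1 - Real.exp (-(c * x)) := by
        have hg' : 0 ≤ γ * Real.log γ + 1 - Real.exp (-(c * γ)) := by linarith
        have h3 := mul_nonneg (div_pos hx hγ).le hg'
        have e3 : x / γ * (γ * Real.log γ + 1 - Real.exp (-(c * γ)))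
          = x * Real.log γ + x / γ - x / γ * Real.exp (-(c * γ)) := by field_simp
        linarith
      -- value at `w = 0`
      have h0 : 0 ≤ x * Real.log γ - γ + 1 := by
        have h2 := mul_log_aux hγ one_pos
        rw [Real.log_one] at h2
        have h3 : Real.log γ ≤ 0 := Real.log_nonpos hγ.le hγ1
        nlinarith
      have := mul_nonneg hw0 h1
      have := mul_nonneg (sub_nonneg.2 hw1) h0
      nlinarith

/-- Domination of `F_TS` by the cross objective:
`max_{[0,1]²} F_TS ≤ max_{[0,1]²} F_Cross`. -/
theorem TS_le_Cross (B α αf : ℝ) (hB : B ∈ Ioo (0:ℝ) 1) (hα : 0 ≤ α)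
    (hαf : 0 < αf) :
    maxTS B α αf ≤
      sSup ((fun p : ℝ × ℝ => FCross B α αf p.1 p.2) '' (Icc 0 1 ×ˢ Icc 0 1)) := by
  obtain ⟨hB0, hB1⟩ := hB
  have hM1 : 0 ≤ M1 B α αf := by unfold M1; nlinarith
  have hM2 : 0 ≤ M2 B α αf := by unfold M2; nlinarith
  have hb : 0 < B / 2 := by linarith
  have ha : 0 < 1 - B / 2 := by linarith
  have hs : 0 < α + αf := by linarith
  have hc : 0 ≤ 2 * α * (1 - B / 2) := by positivity
  obtain ⟨γ, hγdef⟩ : ∃ γ, γ = sSup ((fun y => Real.exp (-(2*α*(1 - B/2)*y))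
    + y*(1 - Real.log y) - 1) '' Ioc 0 1) := ⟨_, rfl⟩
  have hG : Gam B α = (1 - B / 2) * γ := by rw [hγdef]; rfl
  have hub : ∀ z ∈ ((fun y => Real.exp (-(2*α*(1 - B/2)*y))
    + y*(1 - Real.log y) - 1) '' Ioc 0 1), z ≤ 1 := by
    rintro _ ⟨y, ⟨hy0, hy1⟩, rfl⟩
    have h1 : Real.exp (-(2*α*(1 - B/2)*y)) ≤ 1 :=
      Real.exp_le_one_iff.2 (neg_nonpos.2 (mul_nonneg hc hy0.le))
    have h2 := mul_log_aux hy0 one_pos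
    rw [Real.log_one] at h2
    simp only
    linarith
  have hsup : ∀ y, 0 < y → y ≤ 1 →
      Real.exp (-(2*α*(1 - B/2) * y)) + y * (1 - Real.log y) - 1 ≤ γ := by
    intro y h0 h1
    rw [hγdef]
    exact le_csSup ⟨1, hub⟩ ⟨y, ⟨h0, h1⟩, rfl⟩
  have hγ1 : γ ≤ 1 := by
    rw [hγdef]
    exact csSup_le (Set.Nonempty.image _ ⟨1, one_pos, le_rfl⟩) hub
  have hγ : 0 < γ := by
    have h1 := hsup 1 one_pos le_rfl
    rw [Real.log_one] at h1
    have := Real.exp_pos (-(2*α*(1 - B/2) * 1))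
    linarith
  have hΓ : 0 < Gam B α := by rw [hG]; positivity
  have hbdd : BddAbove ((fun p : ℝ × ℝ => FCross B α αf p.1 p.2) '' (Icc 0 1 ×ˢ Icc 0 1)) := by
    apply IsCompact.bddAbove
    apply (isCompact_Icc.prod isCompact_Icc).image
    unfold FCross
    fun_prop
  unfold maxTS
  refine csSup_le (Set.Nonempty.image _ ⟨(0, 0), by simp⟩) ?_
  rintro _ ⟨⟨t₁, t₂⟩, ⟨⟨h10, h11⟩, ⟨h20, h21⟩⟩, rfl⟩
  simp only at h10 h11 h20 h21 ⊢
  unfold FTS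
  have hx := Real.exp_pos (-(M1 B α αf * t₁))
  have hx1 : Real.exp (-(M1 B α αf * t₁)) ≤ 1 :=
    Real.exp_le_one_iff.2 (neg_nonpos.2 (mul_nonneg hM1 h10))
  have hlx : 1 + M1 B α αf * t₁ = 1 - Real.log (Real.exp (-(M1 B α αf * t₁))) := by
    rw [Real.log_exp]; ring
  have hy := Real.exp_pos (-(M2 B α αf * t₂))
  have hy1 : Real.exp (-(M2 B α αf * t₂)) ≤ 1 :=
    Real.exp_le_one_iff.2 (neg_nonpos.2 (mul_nonneg hM2 h20))
  have hly : 1 + M2 B α αf * t₂ = 1 - Real.log (Real.exp (-(M2 B α αf * t₂))) := by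
    rw [Real.log_exp]; ring
  rw [hlx, hly]
  generalize Real.exp (-(M1 B α αf * t₁)) = x at *
  generalize Real.exp (-(M2 B α αf * t₂)) = y at *
  have hw0 := Real.exp_pos (-(B / 2 * (α + αf) * y))
  have hw1 : Real.exp (-(B / 2 * (α + αf) * y)) ≤ 1 :=
    Real.exp_le_one_iff.2 (neg_nonpos.2 (by positivity))
  obtain ⟨u, hu0, hu1, hux, hcore⟩ := core_aux hγ hγ1 hsup hx hx1 hw0.le hw1
  obtain ⟨τ₂, hτ₂, hr₂⟩ := range_aux (p := Gam B α) (q := B / 2) hΓ hb hs hy hy1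
  obtain ⟨τ₁, hτ₁, hr₁⟩ := range_aux (p := B / 2) (q := Gam B α) hb hΓ hs hu0 hu1
  refine le_trans ?_ (le_csSup hbdd ⟨(τ₁, τ₂), ⟨hτ₁, hτ₂⟩, rfl⟩)
  simp only [FCross, M1', M2']
  have e1 : Real.exp (-(2*α*(1 - B/2) * x) - (α + αf)*(B/2) * y)
      = Real.exp (-(2*α*(1 - B/2) * x)) * Real.exp (-(B / 2 * (α + αf) * y)) := by
    rw [← Real.exp_add]; congr 1; ring
  have e2 : Real.exp (-((α + αf)*(1 - B/2) * x) - αf*B * y)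
      ≤ Real.exp (-(Gam B α * (α + αf) * u)) := by
    apply Real.exp_le_exp.2
    have h1 : 0 ≤ αf * B * y := by positivity
    have h2 : 0 ≤ (α + αf) * (1 - B / 2) * (x - γ * u) :=
      mul_nonneg (by positivity) (by linarith)
    rw [hG]
    linarith
  rw [e1]
  have h3 := mul_le_mul_of_nonneg_left e2 hb.le
  have h4 := mul_le_mul_of_nonneg_left hcore ha.le
  have h5 : (1 - B / 2) * (γ * Real.exp (-(B / 2 * (α + αf) * y)) - γ + γ * (u * (1 - Real.log u)))
      = Gam B α * Real.exp (-(B / 2 * (α + αf) * y)) - Gam B α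
        + Gam B α * (u * (1 - Real.log u)) := by rw [hG]; ring
  rw [h5] at h4
  linarith
end

section
/- Let B ∈ (0,1), α ≥ 0, and α_f > 0, and let Γ, M′₁, M′₂, and F_Cross be as defined in the context. Define Λ = sup_{v∈(0,Γ]} [(B/2)·e^{−(α+α_f)v} + v·(1 − ln(v/Γ)) − Γ]. Then max_{(t₁,t₂)∈[0,1]²} F_Cross(t₁,t₂) = Γ − B/2 + 2Λ. -/
open Set

/-- `Λ = sup_{v∈(0,Γ]} [(B/2)e^{−(α+α_f)v} + v(1 − ln(v/Γ)) − Γ]`. -/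
noncomputable def Lam (B α αf : ℝ) : ℝ :=
  sSup ((fun v => (B/2) * Real.exp (-((α + αf)*v))
      + v * (1 - Real.log (v / Gam B α)) - Gam B α) '' Ioc 0 (Gam B α))

/-- One-variable profile. -/
noncomputable def Qf (b G s t : ℝ) : ℝ :=
  b * Real.exp (-(G * s * Real.exp (-(b * s * t))))
    + G * Real.exp (-(b * s * t)) * (1 + b * s * t)

lemma Qf_swap (b G s t : ℝ) (hG : 0 < G) :
    Qf b G s t ≤ Qf G b s (Real.exp (-(b * s * t))) := by
  unfold Qf
  set x := b * s * t with hx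
  set w := b * Real.exp (-(G * s * Real.exp (-x))) with hw
  have e : b * s * Real.exp (-(G * s * Real.exp (-x))) = s * w := by rw [hw]; ring
  rw [e]
  have h1 := Real.add_one_le_exp (x - s * w)
  have h2 : Real.exp (-(s * w)) = Real.exp (-x) * Real.exp (x - s * w) := by
    rw [← Real.exp_add]; congr 1; ring
  have h3 : Real.exp (-x) * (x - s * w + 1) ≤ Real.exp (-(s * w)) := by
    rw [h2]; exact mul_le_mul_of_nonneg_left h1 (Real.exp_pos _).le
  have h4 := mul_le_mul_of_nonneg_left h3 hG.le
  nlinarith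

lemma exp_mem (b s t : ℝ) (hb : 0 < b) (hs : 0 < s) (ht : 0 ≤ t) :
    Real.exp (-(b * s * t)) ∈ Icc (0:ℝ) 1 := by
  refine ⟨(Real.exp_pos _).le, Real.exp_le_one_iff.2 ?_⟩
  have : 0 ≤ b * s * t := by positivity
  linarith

lemma Gam_pos (B α : ℝ) (hB : B ∈ Ioo (0:ℝ) 1) (hα : 0 ≤ α) : 0 < Gam B α := by
  obtain ⟨h0, h1⟩ := hB
  have hc : 0 < 1 - B/2 := by linarith
  unfold Gam
  refine mul_pos hc ?_
  refine lt_of_lt_of_le (Real.exp_pos (-(2*α*(1 - B/2)*1))) (le_csSup ?_ ⟨1, by simp, by simp⟩)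
  refine ⟨1, ?_⟩
  rintro _ ⟨y, ⟨hy0, hy1⟩, rfl⟩
  have h2 : Real.exp (-(2*α*(1 - B/2)*y)) ≤ 1 := by
    refine Real.exp_le_one_iff.2 ?_
    have : 0 ≤ 2*α*(1 - B/2)*y := by positivity
    linarith
  have h3 := Real.one_sub_inv_le_log_of_pos hy0
  have h4 := mul_le_mul_of_nonneg_left h3 hy0.le
  rw [mul_sub, mul_inv_cancel₀ hy0.ne'] at h4
  show Real.exp (-(2*α*(1 - B/2)*y)) + y*(1 - Real.log y) - 1 ≤ 1
  linarith

/-- The maximum of the cross objective decouples: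
`max_{[0,1]²} F_Cross = Γ − B/2 + 2Λ`. -/
theorem Cross_max_eq (B α αf : ℝ) (hB : B ∈ Ioo (0:ℝ) 1) (hα : 0 ≤ α)
    (hαf : 0 < αf) :
    sSup ((fun p : ℝ × ℝ => FCross B α αf p.1 p.2) '' (Icc 0 1 ×ˢ Icc 0 1))
      = Gam B α - B/2 + 2 * Lam B α αf := by
  have hG := Gam_pos B α hB hα
  have hb : 0 < B/2 := by linarith [hB.1]
  have hs : 0 < α + αf := by linarith
  have hF : ∀ t₁ t₂, FCross B α αf t₁ t₂ = Qf (B/2) (Gam B α) (α+αf) t₁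
      + Qf (Gam B α) (B/2) (α+αf) t₂ - (Gam B α + B/2) := by
    intro t₁ t₂
    unfold FCross Qf M1' M2'
    ring
  unfold Lam
  generalize Gam B α = G at *
  generalize B/2 = b at *
  generalize α + αf = s at *
  obtain ⟨a, ha, hmax⟩ := (isCompact_Icc (a := (0:ℝ)) (b := 1)).exists_isMaxOn
    ⟨0, by simp⟩ (f := Qf b G s) (by unfold Qf; fun_prop)
  have hP : ∀ t, 0 ≤ t → Qf G b s t ≤ Qf b G s a := fun t ht =>
    (Qf_swap G b s t hb).trans (hmax (exp_mem G s t hG hs ht))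
  have hQ : ∀ t, 0 ≤ t → Qf b G s t ≤ Qf b G s a := fun t ht =>
    (Qf_swap b G s t hG).trans (hP _ (Real.exp_pos _).le)
  have ha' := exp_mem b s a hb hs ha.1
  have hPa : Qf G b s (Real.exp (-(b * s * a))) = Qf b G s a :=
    le_antisymm (hP _ ha'.1) (Qf_swap b G s a hG)
  have hL : IsGreatest ((fun v => b * Real.exp (-(s*v))
      + v * (1 - Real.log (v / G)) - G) '' Ioc 0 G) (Qf b G s a - G) := by
    constructor
    · have h1 := exp_mem b s a hb hs ha.1
      refine ⟨G * Real.exp (-(b * s * a)), ⟨by positivity, ?_⟩, ?_⟩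
      · nlinarith [h1.2]
      · have : G * Real.exp (-(b * s * a)) / G = Real.exp (-(b * s * a)) := by field_simp
        simp only [this, Real.log_exp, Qf]
        ring_nf
    · rintro _ ⟨v, ⟨hv0, hv1⟩, rfl⟩
      have hl : Real.log (v / G) ≤ 0 :=
        Real.log_nonpos (by positivity) ((div_le_one hG).2 hv1)
      have ht : 0 ≤ -Real.log (v / G) / (b * s) := div_nonneg (by linarith) (by positivity)
      have h := hQ _ ht
      have e : b * s * (-Real.log (v / G) / (b * s)) = -Real.log (v / G) := by
        field_simp
      have e2 : Qf b G s (-Real.log (v / G) / (b * s))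
          = b * Real.exp (-(s*v)) + v * (1 - Real.log (v / G)) := by
        unfold Qf
        rw [e, neg_neg, Real.exp_log (by positivity)]
        have h5 : G * s * (v / G) = s * v := by field_simp
        have h6 : G * (v / G) = v := by field_simp
        rw [h5, h6]; ring
      rw [e2] at h
      show b * Real.exp (-(s*v)) + v * (1 - Real.log (v / G)) - G ≤ _
      linarith
  rw [hL.csSup_eq]
  have hM : IsGreatest ((fun p : ℝ × ℝ => FCross B α αf p.1 p.2) '' (Icc 0 1 ×ˢ Icc 0 1))
      (G - b + 2 * (Qf b G s a - G)) := by
    constructor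
    · refine ⟨(a, Real.exp (-(b * s * a))), ⟨ha, ha'⟩, ?_⟩
      simp only [hF, hPa]
      ring
    · rintro _ ⟨⟨t₁, t₂⟩, ⟨h1, h2⟩, rfl⟩
      simp only [hF]
      linarith [hQ t₁ h1.1, hP t₂ h2.1]
  exact hM.csSup_eq
end

section
/- Let B ∈ (0,1) and α ≥ 0, and set Γ = (1−B/2)·sup_{y∈(0,1]}(e^{−2α(1−B/2)y} + y(1 − ln y) − 1) and m_reg = 2(1−B/2)(1 − (1−B/2)α − e^{−2α(1−B/2)}). Then (1−B/2)·e^{−2α(1−B/2)} ≤ Γ ≤ 1 − B/2 − m_reg. -/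
open Set

lemma key_bound (c y : ℝ) (hc : 0 ≤ c) (hy : 0 < y) (hy1 : y ≤ 1) :
    Real.exp (-(c*y)) + y*(1 - Real.log y) - 1 ≤ c + 2 * Real.exp (-c) - 1 := by
  have h1 : y * (1 + (-c - Real.log y)) ≤ Real.exp (-c) := by
    have h := Real.add_one_le_exp (-c - Real.log y)
    have h2 : y * Real.exp (-c - Real.log y) = Real.exp (-c) := by
      rw [Real.exp_sub, Real.exp_log hy]
      field_simp
    rw [← h2]
    exact mul_le_mul_of_nonneg_left (by linarith) hy.le
  have hcy : 0 ≤ c * y := by positivity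
  have hcy' : c * y ≤ c := mul_le_of_le_one_right hc hy1
  have h3 : Real.exp (-(c*y)) ≤ 1 := Real.exp_le_one_iff.mpr (by linarith)
  have h4 := Real.add_one_le_exp (-(c - c*y))
  have h5 : Real.exp (-c) = Real.exp (-(c*y)) * Real.exp (-(c - c*y)) := by
    rw [← Real.exp_add]; congr 1; ring
  have h6 : Real.exp (-(c*y)) - Real.exp (-c) ≤ c - c*y := by
    rw [h5]
    nlinarith [Real.exp_pos (-(c*y))]
  linarith

/-- Bounds on `Γ`: `(1−B/2)e^{−2α(1−B/2)} ≤ Γ ≤ 1 − B/2 − m_reg`. -/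
theorem Gamma_bounds (B α : ℝ) (hB : B ∈ Ioo (0:ℝ) 1) (hα : 0 ≤ α) :
    (1 - B/2) * Real.exp (-(2*α*(1 - B/2))) ≤ Gam B α ∧
    Gam B α ≤ 1 - B/2 - mreg B α := by
  obtain ⟨hB0, hB1⟩ := hB
  have hb : 0 < 1 - B/2 := by linarith
  have hc : 0 ≤ 2*α*(1 - B/2) := by positivity
  have hub : ∀ z ∈ ((fun y => Real.exp (-(2*α*(1 - B/2)*y)) + y*(1 - Real.log y) - 1) '' Ioc 0 1),
      z ≤ 2*α*(1 - B/2) + 2 * Real.exp (-(2*α*(1 - B/2))) - 1 := by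
    rintro z ⟨y, ⟨hy, hy1⟩, rfl⟩
    exact key_bound _ y hc hy hy1
  constructor
  · unfold Gam
    refine mul_le_mul_of_nonneg_left (le_csSup ⟨_, hub⟩ ⟨1, ⟨one_pos, le_rfl⟩, ?_⟩) hb.le
    simp
  · have h := csSup_le ((nonempty_Ioc.mpr one_pos).image _) hub
    have h' := mul_le_mul_of_nonneg_left h hb.le
    unfold Gam mreg
    refine h'.trans (le_of_eq ?_)
    ring
end

section
/- Let B ∈ (0,1), α ≥ 0, and α_f > 0. With Γ = (1−B/2)·sup_{y∈(0,1]}(e^{−2α(1−B/2)y} + y(1 − ln y) − 1), Λ = sup_{v∈(0,Γ]} [(B/2)·e^{−(α+α_f)v} + v·(1 − ln(v/Γ)) − Γ], and C_FMZ = (2/α_f)(e^{α_f B/2} − 1)·exp(−α_f(1−B/2)·e^{−2α(1−B/2)}), we have 2Λ ≤ C_FMZ. -/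
open Set

lemma aux_G (a v G : ℝ) (hv : 0 < v) (hG : v ≤ G) (ha : 0 < a) :
    0 ≤ G - v - v * (Real.log G - Real.log v) - (G - v) * Real.exp (-(a*v))
      + (Real.exp (-(a*v)) - Real.exp (-(a*G))) / a := by
  set φ : ℝ → ℝ := fun G => G - v - v * (Real.log G - Real.log v) - (G - v) * Real.exp (-(a*v))
      + (Real.exp (-(a*v)) - Real.exp (-(a*G))) / a with hφ
  have hd : ∀ x, 0 < x → HasDerivAt φ (1 - v * (1 / x) - 1 * Real.exp (-(a*v))
      + (- (Real.exp (-(a*x)) * (-(a*1)))) / a) x := by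
    intro x hx
    have h1 := hasDerivAt_id' x
    have h2 : HasDerivAt (fun G => Real.log G - Real.log v) (1 / x) x := by
      simpa using (Real.hasDerivAt_log hx.ne').sub_const (Real.log v)
    have h3 : HasDerivAt (fun G => Real.exp (-(a*v)) - Real.exp (-(a*G)))
        (- (Real.exp (-(a*x)) * (-(a*1)))) x :=
      (((h1.const_mul a).neg).exp).const_sub _
    exact (((h1.sub_const v).sub (h2.const_mul v)).sub
      ((h1.sub_const v).mul_const _)).add (h3.div_const a)
  have hmono : MonotoneOn φ (Icc v G) := by
    apply monotoneOn_of_deriv_nonneg (convex_Icc v G)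
    · intro x hx
      exact (hd x (lt_of_lt_of_le hv hx.1)).continuousAt.continuousWithinAt
    · intro x hx
      rw [interior_Icc] at hx
      exact (hd x (hv.trans hx.1)).differentiableAt.differentiableWithinAt
    · intro x hx
      rw [interior_Icc] at hx
      have hx0 : 0 < x := hv.trans hx.1
      rw [(hd x hx0).deriv]
      have hc := convexOn_exp.2 (mem_univ (-(a*x))) (mem_univ (0:ℝ))
        (show 0 ≤ v / x by positivity)
        (show 0 ≤ 1 - v / x by rw [sub_nonneg, div_le_one hx0]; exact hx.1.le) (by ring)
      simp only [smul_eq_mul, Real.exp_zero, mul_zero, add_zero, mul_one] at hc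
      have e1 : v / x * -(a * x) = -(a*v) := by field_simp
      rw [e1] at hc
      have e2 : (- (Real.exp (-(a*x)) * (-(a*1)))) / a = Real.exp (-(a*x)) := by field_simp
      rw [e2]
      have hle : v / x ≤ 1 := by rw [div_le_one hx0]; exact hx.1.le
      have e3 : v * (1 / x) = v / x := by ring
      rw [e3]
      have := mul_le_mul_of_nonneg_right hle (Real.exp_pos (-(a*x))).le
      linarith
  have := hmono (left_mem_Icc.2 hG) (right_mem_Icc.2 hG) hG
  have h0 : φ v = 0 := by simp [hφ]
  rw [h0] at this
  exact this

lemma aux_main_s15 (a b v G : ℝ) (hv : 0 < v) (hG : v ≤ G) (ha : 0 < a) :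
    b * Real.exp (-(a*v)) + v * (1 - Real.log (v / G)) - G
      ≤ (Real.exp (a*b) - 1) / a * Real.exp (-(a*G)) := by
  have h := aux_G a v G hv hG ha
  have hG0 : 0 < G := hv.trans_le hG
  rw [Real.log_div hv.ne' hG0.ne']
  have ht : Real.exp (-(a*v)) * (1 + a*(b - (G - v))) ≤ Real.exp (a*b) * Real.exp (-(a*G)) := by
    have h1 := Real.add_one_le_exp (a*(b - (G - v)))
    have h2 : Real.exp (a*b) * Real.exp (-(a*G))
        = Real.exp (-(a*v)) * Real.exp (a*(b - (G - v))) := by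
      rw [← Real.exp_add, ← Real.exp_add]; congr 1; ring
    rw [h2]
    exact mul_le_mul_of_nonneg_left (by linarith) (Real.exp_pos _).le
  have e : (Real.exp (a*b) - 1) / a * Real.exp (-(a*G))
      = (Real.exp (a*b) * Real.exp (-(a*G)) - Real.exp (-(a*v))) / a
        + (Real.exp (-(a*v)) - Real.exp (-(a*G))) / a := by ring
  have h3 : Real.exp (-(a*v)) * (b - (G - v))
      ≤ (Real.exp (a*b) * Real.exp (-(a*G)) - Real.exp (-(a*v))) / a := by
    rw [le_div_iff₀ ha]; linarith
  rw [e]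
  linarith

lemma Gam_ge (B α : ℝ) (hB : B ∈ Ioo (0:ℝ) 1) (hα : 0 ≤ α) :
    (1 - B/2) * Real.exp (-(2*α*(1 - B/2))) ≤ Gam B α := by
  have hc : 0 ≤ 1 - B/2 := by linarith [hB.2]
  unfold Gam
  apply mul_le_mul_of_nonneg_left _ hc
  apply le_csSup
  · refine ⟨1, ?_⟩
    rintro _ ⟨y, hy, rfl⟩
    have h1 : Real.exp (-(2*α*(1 - B/2)*y)) ≤ 1 := by
      rw [Real.exp_le_one_iff]
      have := hy.1.le
      have : 0 ≤ 2*α*(1 - B/2)*y := by positivity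
      linarith
    have h2 := Real.one_sub_inv_le_log_of_pos hy.1
    have h3 := mul_le_mul_of_nonneg_left h2 hy.1.le
    have h4 : y * (1 - y⁻¹) = y - 1 := by
      have := hy.1.ne'
      field_simp
    simp only
    linarith
  · exact ⟨1, by simp, by simp⟩

/-- `2Λ ≤ C_FMZ`. -/
theorem two_Lambda_le_CFMZ (B α αf : ℝ) (hB : B ∈ Ioo (0:ℝ) 1) (hα : 0 ≤ α)
    (hαf : 0 < αf) :
    2 * Lam B α αf ≤ CFMZ B α αf := by
  have hg := Gam_ge B α hB hα
  have hc : 0 < 1 - B/2 := by linarith [hB.2]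
  have hpos : 0 < Gam B α := lt_of_lt_of_le (mul_pos hc (Real.exp_pos _)) hg
  have hB0 := hB.1
  have key : Lam B α αf ≤ (Real.exp (αf*(B/2)) - 1) / αf *
      Real.exp (-(αf*(1 - B/2)*Real.exp (-(2*α*(1 - B/2))))) := by
    unfold Lam
    apply csSup_le
    · exact ⟨_, Gam B α, ⟨hpos, le_rfl⟩, rfl⟩
    · rintro _ ⟨v, hv, rfl⟩
      simp only
      have h1 := aux_main_s15 αf (B/2) v (Gam B α) hv.1 hv.2 hαf
      have h2 : Real.exp (-((α + αf)*v)) ≤ Real.exp (-(αf*v)) := by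
        apply Real.exp_le_exp.2
        have := mul_nonneg hα hv.1.le
        linarith
      have h3 := mul_le_mul_of_nonneg_left h2 (show 0 ≤ B/2 by positivity)
      have h4 : Real.exp (-(αf * Gam B α))
          ≤ Real.exp (-(αf*(1 - B/2)*Real.exp (-(2*α*(1 - B/2))))) := by
        apply Real.exp_le_exp.2
        have := mul_le_mul_of_nonneg_left hg hαf.le
        linarith
      have h5 : 0 ≤ (Real.exp (αf*(B/2)) - 1) / αf := by
        apply div_nonneg _ hαf.le
        have := Real.one_le_exp (show 0 ≤ αf*(B/2) by positivity)
        linarith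
      have h6 := mul_le_mul_of_nonneg_left h4 h5
      linarith
  unfold CFMZ
  have e : αf*B/2 = αf*(B/2) := by ring
  rw [e]
  calc _ ≤ 2 * _ := mul_le_mul_of_nonneg_left key (by norm_num)
    _ = _ := by ring
end

section
/- For every B ∈ (0,1) and every z > 0, the function R(z) = (2(1−B)/B)·(1 − e^{−Bz/(2−B)}) satisfies R(z) < z. Equivalently, (1−B)·(e^{−(2/(2−B))z} − e^{−z}) + (B/2)·z·e^{−z} > 0 for all z > 0 and B ∈ (0,1). -/
/-- For `B ∈ (0,1)` and `z > 0`: `R(z) = (2(1−B)/B)(1 − e^{−Bz/(2−B)}) < z`;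
equivalently `(1−B)(e^{−(2/(2−B))z} − e^{−z}) + (B/2)z e^{−z} > 0`. -/
theorem R_lt_z (B z : ℝ) (hB0 : 0 < B) (hB1 : B < 1) (hz : 0 < z) :
    (2*(1 - B)/B) * (1 - Real.exp (-(B*z/(2 - B)))) < z ∧
    0 < (1 - B) * (Real.exp (-((2/(2 - B))*z)) - Real.exp (-z))
        + (B/2) * z * Real.exp (-z) := by
  have h2 : 0 < 2 - B := by linarith
  have hexp := Real.add_one_le_exp (-(B*z/(2 - B)))
  have hu : (1 - B) * (B*z/(2 - B)) < B*z/2 := by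
    rw [← mul_div_assoc, div_lt_div_iff₀ h2 two_pos]
    nlinarith [mul_pos (mul_pos hB0 hz) hB0]
  have key : (1 - B) * (1 - Real.exp (-(B*z/(2 - B)))) < B*z/2 := by
    refine lt_of_le_of_lt ?_ hu
    exact mul_le_mul_of_nonneg_left (by linarith) (by linarith)
  constructor
  · have : (2*(1 - B)/B) * (1 - Real.exp (-(B*z/(2 - B))))
        = 2 * ((1 - B) * (1 - Real.exp (-(B*z/(2 - B))))) / B := by ring
    rw [this, div_lt_iff₀ hB0]
    linarith
  · have he : Real.exp (-((2/(2 - B))*z)) = Real.exp (-z) * Real.exp (-(B*z/(2 - B))) := by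
      rw [← Real.exp_add]
      congr 1
      field_simp
      ring
    rw [he]
    have := mul_pos (Real.exp_pos (-z)) (sub_pos.2 key)
    linarith
end
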